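/- arXiv:2012.03523 — 2 statements merged into one kernel-verified Lean document; each statement's English description precedes it below -/
import Mathlib

section
/- (Inverse of the Betti-type matrix Σ_{2k−1} via Bernoulli numbers.) Let k ≥ 2. Let Σ_{2k−1} be the (2k−1)×(2k−1) rational matrix defined in the context, and let 𝓑_{2k−1} be the (2k−1)×(2k−1) rational matrix with entries, for 1 ≤ a,b ≤ 2k−1: if a ≤ k and b ≤ k, (𝓑)_{a,b} = 2^{2−2k}·δ_{min(a,b),1}·(2k)!·B_{2k+2−a−b} / ( (2k+1)·(−1)^{k+1+⌊(2k+1−a−b)/2⌋} ); if exactly one of a,b is ≤ k, (𝓑)_{a,b} = 2^{2−2k}·( ((k−a−b)/(2k+1))·δ_{min(a,b),1} + 1 )·( (3k−1−max(a,b))!·(2k+1−min(a,b))! / (3k+1−a−b)! )·B_{3k+1−a−b} / (−1)^{max(a,b)+1+⌊(3k−a−b)/2⌋}; if a ≥ k+1 and b ≥ k+1, (𝓑)_{a,b} = 2^{2−2k}·(4k−1−a−b)·( (3k−1−a)!·(3k−1−b)! / (4k−a−b)! )·B_{4k−a−b} / (−1)^{a+1+⌊(4k−1−a−b)/2⌋}.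 Then Σ_{2k−1} · 𝓑_{2k−1} is the (2k−1)×(2k−1) identity matrix; i.e. 𝓑_{2k−1} = Σ_{2k−1}⁻¹. -/
open scoped BigOperators
open Matrix Polynomial Filter

/-- Entry of the block `Σᴬ` (1-based indices `a, b ∈ [1,k]`). -/
noncomputable def SigA (k a b : ℕ) : ℚ :=
  ((1 + (-1 : ℚ) ^ (a + b)) / 2) * (1 + 2 * k * (if a = 1 then (1 : ℚ) else 0)) *
    (1 + 2 * k * (if b = 1 then (1 : ℚ) else 0)) * 2 ^ (2 * k - 1) *
    (-1 : ℚ) ^ ((k : ℤ) - ((a / 2 : ℕ) : ℤ) - ((b / 2 : ℕ) : ℤ)) *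
    ((∑ s ∈ Finset.Icc 1 (k + 1 - a),
        (-1 : ℚ) ^ s * ((2 * k + 1 - a).choose (k + s) : ℚ) * ((k - s).choose (b - 1) : ℚ)) /
      (((a - 1).factorial : ℚ) * ((2 * k + 1 - a).factorial : ℚ)))

/-- Entry of the block `Σᴮ` (1-based indices `a ∈ [1,k]`, `b ∈ [1,k-1]`). -/
noncomputable def SigB (k a b : ℕ) : ℚ :=
  (((-1 : ℚ) ^ (a - 1) + (-1 : ℚ) ^ b) / 2) * (1 + 2 * k * (if a = 1 then (1 : ℚ) else 0)) *
    2 ^ (2 * k - 1) * (-1 : ℚ) ^ ((k : ℤ) - ((a / 2 : ℕ) : ℤ) - ((b / 2 : ℕ) : ℤ)) *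
    ((∑ s ∈ Finset.Icc 1 (k + 1 - a),
        (-1 : ℚ) ^ s * ((2 * k + 1 - a).choose (k + s) : ℚ) *
          (((k - s).choose (b + 1) : ℚ) + (-1 : ℚ) ^ b * ((k + s).choose (b + 1) : ℚ))) /
      (((a - 1).factorial : ℚ) * ((2 * k + 1 - a).factorial : ℚ)))

/-- Entry of the block `Σᴰ` (1-based indices `a, b ∈ [1,k-1]`). -/
noncomputable def SigD (k a b : ℕ) : ℚ :=
  ((-4 : ℚ) ^ (k - 1) / ((k.factorial : ℚ) ^ 2)) *
    ((1 + (-1 : ℚ) ^ a) * (1 + (-1 : ℚ) ^ b) /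
      (-1 : ℚ) ^ ((a / 2 : ℕ) + (b / 2 : ℕ))) *
    (k.choose (a + 1) : ℚ) * (k.choose (b + 1) : ℚ)

/-- The symmetric `(2k-1) × (2k-1)` rational matrix `Σ_{2k-1}`, in block form
`((Σᴬ, Σᴮ), (Σᴮᵀ, Σᴰ))`. -/
noncomputable def SigmaMat (k : ℕ) : Matrix (Fin (2 * k - 1)) (Fin (2 * k - 1)) ℚ :=
  Matrix.of fun i j =>
    if (i : ℕ) + 1 ≤ k then
      (if (j : ℕ) + 1 ≤ k then SigA k ((i : ℕ) + 1) ((j : ℕ) + 1)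
       else SigB k ((i : ℕ) + 1) ((j : ℕ) + 1 - k))
    else
      (if (j : ℕ) + 1 ≤ k then SigB k ((j : ℕ) + 1) ((i : ℕ) + 1 - k)
       else SigD k ((i : ℕ) + 1 - k) ((j : ℕ) + 1 - k))


/-- Entries of the candidate inverse matrix `𝓑_{2k-1}` (1-based indices). -/
noncomputable def BcalEntry (k a b : ℕ) : ℚ :=
  if a ≤ k ∧ b ≤ k then
    (2 : ℚ) ^ ((2 : ℤ) - 2 * k) * (if min a b = 1 then (1 : ℚ) else 0) *
      ((2 * k).factorial : ℚ) * _root_.bernoulli (2 * k + 2 - a - b) /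
      ((2 * (k : ℚ) + 1) * (-1 : ℚ) ^ (k + 1 + (2 * k + 1 - a - b) / 2))
  else if a ≤ k ∨ b ≤ k then
    (2 : ℚ) ^ ((2 : ℤ) - 2 * k) *
      (((k : ℚ) - a - b) / (2 * (k : ℚ) + 1) * (if min a b = 1 then (1 : ℚ) else 0) + 1) *
      (((3 * k - 1 - max a b).factorial : ℚ) * ((2 * k + 1 - min a b).factorial : ℚ) /
        ((3 * k + 1 - a - b).factorial : ℚ)) *
      _root_.bernoulli (3 * k + 1 - a - b) / (-1 : ℚ) ^ (max a b + 1 + (3 * k - a - b) / 2)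
  else
    (2 : ℚ) ^ ((2 : ℤ) - 2 * k) * ((4 * (k : ℚ) - 1 - a - b)) *
      (((3 * k - 1 - a).factorial : ℚ) * ((3 * k - 1 - b).factorial : ℚ) /
        ((4 * k - a - b).factorial : ℚ)) *
      _root_.bernoulli (4 * k - a - b) / (-1 : ℚ) ^ (a + 1 + (4 * k - 1 - a - b) / 2)

/-- umbral functional -/
noncomputable def Lf : ℚ[X] →ₗ[ℚ] ℚ :=
  Polynomial.lsum fun n => (_root_.bernoulli n) • (LinearMap.id : ℚ →ₗ[ℚ] ℚ)

lemma Lf_X_pow (n : ℕ) : Lf (X ^ n) = _root_.bernoulli n := by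
  simp [Lf, Polynomial.lsum_apply, ← Polynomial.monomial_one_right_eq_X_pow, Polynomial.sum_monomial_index]

lemma Lf_X_add_one_pow (n : ℕ) :
    Lf ((X + 1) ^ n) = _root_.bernoulli n + if n = 1 then 1 else 0 := by
  rw [add_pow, map_sum, Finset.sum_range_succ, ← _root_.sum_bernoulli n, add_comm]
  congr 1
  · simp [Lf_X_pow]
  · refine Finset.sum_congr rfl fun i _ => ?_
    have : (X ^ i * 1 ^ (n - i) * ((n.choose i : ℕ) : ℚ[X])) = (n.choose i : ℚ) • X ^ i := by
      rw [Polynomial.smul_eq_C_mul]; simp [mul_comm]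
    rw [this, map_smul, Lf_X_pow, smul_eq_mul]

lemma bern_odd {n : ℕ} (h : Odd n) (h1 : n ≠ 1) : _root_.bernoulli n = 0 := by
  apply bernoulli_eq_zero_of_odd h
  obtain ⟨m, rfl⟩ := h
  omega

/-- reflection -/
noncomputable def Rf (h : ℚ[X]) : ℚ[X] := h.comp (-1 - X)

lemma lin_ext {M : Type*} [AddCommGroup M] [Module ℚ M] (f g : ℚ[X] →ₗ[ℚ] M)
    (h : ∀ n, f (X ^ n) = g (X ^ n)) (p : ℚ[X]) : f p = g p := by
  have : f = g := by
    apply Polynomial.lhom_ext'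
    intro n
    ext
    simpa [← Polynomial.monomial_one_right_eq_X_pow] using h n
  rw [this]

lemma Rf_add (f g : ℚ[X]) : Rf (f + g) = Rf f + Rf g := by simp [Rf]
lemma Rf_mul (f g : ℚ[X]) : Rf (f * g) = Rf f * Rf g := by simp [Rf]
lemma Rf_pow (f : ℚ[X]) (n : ℕ) : Rf (f ^ n) = Rf f ^ n := by simp [Rf]
lemma Rf_X : Rf X = -1 - X := by simp [Rf]
lemma Rf_Xa : Rf (X + 1) = - X := by simp [Rf]; ring
lemma Rf_Rf (f : ℚ[X]) : Rf (Rf f) = f := by simp [Rf, Polynomial.comp_assoc]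

lemma Lf_Rf (h : ℚ[X]) : Lf (Rf h) = Lf h := by
  have := lin_ext (Lf ∘ₗ (Polynomial.compRingHom (-1 - X : ℚ[X])).toAddMonoidHom.toRatLinearMap) Lf
    (fun n => ?_) h
  · simpa [Rf] using this
  · have e : ((-1 - X : ℚ[X])) ^ n = ((-1 : ℚ) ^ n) • (X + 1) ^ n := by
      rw [show (-1 - X : ℚ[X]) = (-1 : ℚ) • (X + 1) by simp; ring, _root_.smul_pow]
    simp [e, Lf_X_add_one_pow, Lf_X_pow]
    rcases Nat.even_or_odd n with hn | hn
    · have : n ≠ 1 := by rintro rfl; simp at hn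
      simp [hn, this]
    · by_cases h1 : n = 1
      · subst h1; norm_num
      · simp [bern_odd hn h1, h1]

lemma der_Rf (h : ℚ[X]) : derivative (Rf h) = - Rf (derivative h) := by
  simp [Rf, Polynomial.derivative_comp]

lemma Rf_neg (f : ℚ[X]) : Rf (-f) = - Rf f := by simp [Rf]
lemma Rf_smul (c : ℚ) (f : ℚ[X]) : Rf (c • f) = c • Rf f := by simp [Rf]

lemma iter_der_Rf (h : ℚ[X]) (n : ℕ) :
    derivative^[n] (Rf h) = (-1 : ℚ) ^ n • Rf (derivative^[n] h) := by
  induction n with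
  | zero => simp
  | succ n ih =>
    rw [Function.iterate_succ_apply', ih, Function.iterate_succ_apply', Polynomial.derivative_smul, der_Rf, pow_succ]
    simp

lemma Lf_shift (h : ℚ[X]) : Lf (h.comp (X + 1)) = Lf h + (derivative h).eval 0 := by
  have := lin_ext (Lf ∘ₗ (Polynomial.compRingHom (X + 1 : ℚ[X])).toAddMonoidHom.toRatLinearMap) (Lf + (Polynomial.leval 0) ∘ₗ derivative)
    (fun n => ?_) h
  · simpa using this
  · simp [Lf_X_add_one_pow, Lf_X_pow]
    rcases n with _ | _ | n <;> simp

/-! ### abstract rows -/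

/-- f_q -/
noncomputable def fq (k q i : ℕ) : ℚ := ((2 * k - i).choose q : ℚ) - (-1) ^ q * (i.choose q : ℚ)

noncomputable def Hp (k i : ℕ) : ℚ[X] := X ^ i * (X + 1) ^ (2 * k - i)

lemma Rf_Hp (k i : ℕ) (hi : i ≤ 2 * k) : Rf (Hp k i) = Hp k (2 * k - i) := by
  rw [Hp, Rf_mul, Rf_pow, Rf_pow, Rf_X, Rf_Xa, Hp, Nat.sub_sub_self hi,
    show (-1 - X : ℚ[X]) = - (X + 1) by ring, neg_pow, neg_pow (X : ℚ[X])]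
  have : (-1 : ℚ[X]) ^ i * (-1) ^ (2 * k - i) = 1 := by
    rw [← pow_add, Nat.add_sub_cancel' hi]; simp
  linear_combination (X + 1) ^ i * X ^ (2 * k - i) * this

/-- expansion of `Hp` under a functional -/
lemma sum_Hp (k i N : ℕ) (hi : i ≤ 2 * k) (hN : 2 * k - i < N) (th : ℚ[X] →ₗ[ℚ] ℚ) :
    ∑ q ∈ Finset.range N, ((2 * k - i).choose q : ℚ) * th (X ^ (2 * k - q)) = th (Hp k i) := by
  have h1 : Hp k i = ∑ q ∈ Finset.range (2 * k - i + 1), ((2 * k - i).choose q : ℚ) • X ^ (2 * k - q) := by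
    rw [Hp, add_comm, add_pow, Finset.mul_sum]
    refine Finset.sum_congr rfl fun q hq => ?_
    have : q ≤ 2 * k - i := by simpa [Nat.lt_succ_iff] using hq
    rw [Polynomial.smul_eq_C_mul, show 2 * k - q = i + (2 * k - i - q) by omega, pow_add]
    simp; ring
  rw [h1, map_sum]
  symm
  rw [← Finset.sum_subset (Finset.range_mono (show 2 * k - i + 1 ≤ N by omega))]
  · simp
  · intro q _ hq
    rw [Nat.choose_eq_zero_of_lt (by simpa using hq)]; simp

/-! ### binomial sums -/

lemma choose_swap (n i p : ℕ) : n.choose i * (n - i).choose p = n.choose p * (n - p).choose i := by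
  by_cases h : i + p ≤ n
  · have h1 := Nat.choose_mul (n := n) (k := i + p) (s := i) (by omega)
    have h2 := Nat.choose_mul (n := n) (k := i + p) (s := p) (by omega)
    rw [Nat.add_sub_cancel_left] at h1
    rw [Nat.add_sub_cancel] at h2
    rw [← h1, ← h2, Nat.choose_symm_add]
  · have key : ∀ a b : ℕ, ¬ a + b ≤ n → n.choose a * (n - a).choose b = 0 := by
      intro a b hab
      rcases Nat.lt_or_ge n a with h' | h'
      · rw [Nat.choose_eq_zero_of_lt h', zero_mul]
      · rw [Nat.choose_eq_zero_of_lt (show n - a < b by omega), mul_zero]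
    rw [key i p h, key p i (by omega)]

lemma sumB {R : Type*} [CommRing R] (n q : ℕ) (x y : R) :
    ∑ i ∈ Finset.range (n + 1), (n.choose i : R) * ((n - i).choose q : R) * x ^ i * y ^ (n - i)
      = n.choose q * y ^ q * (x + y) ^ (n - q) := by
  by_cases hq : q ≤ n
  · rw [add_pow, Finset.mul_sum, ← Finset.sum_subset (Finset.range_mono (show n - q + 1 ≤ n + 1 by omega))]
    · refine Finset.sum_congr rfl fun i hi => ?_
      have hi' : i ≤ n - q := by simpa [Nat.lt_succ_iff] using hi
      have := congrArg (Nat.cast (R := R)) (choose_swap n i q)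
      push_cast at this
      rw [this, show n - i = q + (n - q - i) by omega, pow_add]
      ring
    · intro i hi hi'
      rw [Nat.choose_eq_zero_of_lt (show n - i < q by simp at hi hi'; omega)]
      simp
  · rw [Nat.choose_eq_zero_of_lt (show n < q by omega)]
    simp only [Nat.cast_zero, zero_mul]
    refine Finset.sum_eq_zero fun i hi => ?_
    rw [Nat.choose_eq_zero_of_lt (show n - i < q by omega)]
    simp

lemma sumA {R : Type*} [CommRing R] (n q : ℕ) (x y : R) :
    ∑ i ∈ Finset.range (n + 1), (n.choose i : R) * (i.choose q : R) * x ^ i * y ^ (n - i)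
      = n.choose q * x ^ q * (x + y) ^ (n - q) := by
  rw [add_comm x y, ← sumB n q y x, ← Finset.sum_range_reflect]
  refine Finset.sum_congr rfl fun i hi => ?_
  have hi' : i ≤ n := by simpa [Nat.lt_succ_iff] using hi
  rw [show n + 1 - 1 - i = n - i by omega, Nat.choose_symm hi', Nat.sub_sub_self hi']
  ring

lemma sumT (n p q : ℕ) (hp : p ≤ n) :
    ∑ i ∈ Finset.range (n + 1), (-1 : ℚ) ^ i * (n.choose i : ℚ) * ((n - i).choose p : ℚ) * (i.choose q : ℚ)
      = if p + q = n then (-1) ^ q * (n.choose p : ℚ) else 0 := by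
  have h1 := sumA (n - p) q (-1 : ℚ) 1
  simp only [one_pow, mul_one, neg_add_cancel] at h1
  have h2 : ∑ i ∈ Finset.range (n + 1), (-1 : ℚ) ^ i * (n.choose i : ℚ) * ((n - i).choose p : ℚ) * (i.choose q : ℚ)
      = n.choose p * ∑ i ∈ Finset.range (n - p + 1), (((n - p).choose i : ℕ) : ℚ) * (i.choose q : ℚ) * (-1) ^ i := by
    rw [Finset.mul_sum]
    symm
    rw [Finset.sum_subset (Finset.range_mono (show n - p + 1 ≤ n + 1 by omega))]
    · refine Finset.sum_congr rfl fun i hi => ?_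
      have := congrArg (Nat.cast (R := ℚ)) (choose_swap n i p)
      push_cast at this
      linear_combination (-(i.choose q : ℚ) * (-1) ^ i) * this
    · intro i hi hi'
      rw [Nat.choose_eq_zero_of_lt (show n - p < i by simp at hi hi'; omega)]
      simp
  rw [h2, h1]
  split_ifs with h
  · subst h; simp; ring
  · rcases lt_or_gt_of_ne h with h | h
    · rw [zero_pow (by omega)]; simp
    · rw [Nat.choose_eq_zero_of_lt (show n - p < q by omega)]; simp

lemma sumF (k q : ℕ) (la : ℚ[X] →ₗ[ℚ] ℚ) :
    ∑ i ∈ Finset.range (2 * k + 1), (-1 : ℚ) ^ i * ((2 * k).choose i : ℚ) * fq k q i * la (Hp k i)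
      = ((2 * k).choose q : ℚ) * (la ((X + 1) ^ q) - la (X ^ q)) := by
  have hA := sumA (2 * k) q (-X : ℚ[X]) (X + 1)
  have hB := sumB (2 * k) q (-X : ℚ[X]) (X + 1)
  have h1 : (-X + (X + 1) : ℚ[X]) = 1 := by ring
  rw [h1, one_pow, mul_one] at hA hB
  have key : ∑ i ∈ Finset.range (2 * k + 1),
      ((-1 : ℚ) ^ i * ((2 * k).choose i : ℚ) * fq k q i) • Hp k i
      = ((2 * k).choose q : ℚ) • ((X + 1) ^ q - X ^ q) := by
    have e : ∀ i, ((-1 : ℚ) ^ i * ((2 * k).choose i : ℚ) * fq k q i) • Hp k i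
      = ((2 * k).choose i : ℚ[X]) * ((2 * k - i).choose q : ℚ[X]) * (-X) ^ i * (X + 1) ^ (2 * k - i)
       - (-1) ^ q * (((2 * k).choose i : ℚ[X]) * (i.choose q : ℚ[X]) * (-X) ^ i * (X + 1) ^ (2 * k - i)) := by
      intro i
      rw [Polynomial.smul_eq_C_mul, fq, Hp, neg_pow (X : ℚ[X])]
      simp
      ring
    rw [Finset.sum_congr rfl fun i _ => e i, Finset.sum_sub_distrib, ← Finset.mul_sum, hA, hB,
      Polynomial.smul_eq_C_mul, neg_pow (X : ℚ[X])]
    have : ((-1 : ℚ[X]) ^ q) * (-1) ^ q = 1 := by rw [← mul_pow]; simp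
    simp
    linear_combination (-((2 * k).choose q : ℚ[X]) * X ^ q) * this
  have := congrArg la key
  rw [map_sum, map_smul, map_sub] at this
  simpa using this

lemma sumF0 (k q : ℕ) (hq : q < 2 * k) :
    ∑ i ∈ Finset.range (2 * k + 1), (-1 : ℚ) ^ i * ((2 * k).choose i : ℚ) * fq k q i = 0 := by
  have hA := sumA (2 * k) q (-1 : ℚ) 1
  have hB := sumB (2 * k) q (-1 : ℚ) 1
  simp only [neg_add_cancel, one_pow, mul_one] at hA hB
  rw [zero_pow (by omega), mul_zero] at hA hB
  have e : ∀ i, (-1 : ℚ) ^ i * ((2 * k).choose i : ℚ) * fq k q i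
    = ((2 * k).choose i : ℚ) * ((2 * k - i).choose q : ℚ) * (-1) ^ i
      - (-1) ^ q * (((2 * k).choose i : ℚ) * (i.choose q : ℚ) * (-1) ^ i) := by
    intro i
    rw [fq]; ring
  rw [Finset.sum_congr rfl fun i _ => e i, Finset.sum_sub_distrib, ← Finset.mul_sum, hA, hB]
  simp

/-- upper half of a symmetric sum -/
lemma half_sum (k : ℕ) (G : ℕ → ℚ) (hG : ∀ i, i ≤ 2 * k → G (2 * k - i) = G i) :
    ∑ i ∈ Finset.range (2 * k + 1), G i = G k + 2 * ∑ t ∈ Finset.range k, G (k + 1 + t) := by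
  rw [show 2 * k + 1 = k + 1 + k by omega, Finset.sum_range_add, Finset.sum_range_succ]
  have : ∑ i ∈ Finset.range k, G i = ∑ t ∈ Finset.range k, G (k + 1 + t) := by
    rw [← Finset.sum_range_reflect]
    refine Finset.sum_congr rfl fun i hi => ?_
    have := Finset.mem_range.1 hi
    rw [← hG _ (by omega)]
    congr 1; omega
  rw [this]; ring

lemma half_sum0 (k : ℕ) (G : ℕ → ℚ) (hG : ∀ i, i ≤ k → G i = 0) :
    ∑ t ∈ Finset.range k, G (k + 1 + t) = ∑ i ∈ Finset.range (2 * k + 1), G i := by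
  rw [show 2 * k + 1 = k + 1 + k by omega, Finset.sum_range_add, Finset.sum_eq_zero (s := Finset.range (k+1)), zero_add]
  intro i hi
  exact hG i (by simp at hi; omega)

/-- split off the two first terms -/
lemma split2 (k : ℕ) (hk : 1 ≤ k) (G : ℕ → ℚ) :
    ∑ q ∈ Finset.range (k + 1), G q = G 0 + G 1 + ∑ j ∈ Finset.range (k - 1), G (j + 2) := by
  obtain ⟨m, rfl⟩ : ∃ m, k = m + 1 := ⟨k - 1, by omega⟩
  rw [Finset.sum_range_succ', Finset.sum_range_succ']
  simp; ring

section rows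
variable (k : ℕ) (e : ℚ) (la th : ℚ[X] →ₗ[ℚ] ℚ)

/-- at a point in the upper half (including the middle), the untruncated part of the column function -/
lemma col_fun (hk : 1 ≤ k) (h1 : ∀ h, th h + e * th (Rf h) = - la h)
    (h4 : ∀ q, q ≤ k → th (X ^ (2 * k - q)) * ((-1) ^ q + e) = 0)
    (i : ℕ) (hi : k ≤ i) (hi2 : i ≤ 2 * k) :
    2 * k * th (X ^ (2 * k - 1)) + ∑ j ∈ Finset.range (k - 1), fq k (j + 2) i * th (X ^ (2 * k - (j + 2)))
     = - la (Hp k i) - e * ∑ t ∈ Finset.range k, (i.choose (k + 1 + t) : ℚ) * th (X ^ (2 * k - (k + 1 + t))) := by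
  have s := split2 k hk (fun q => fq k q i * th (X ^ (2 * k - q)))
  have f0 : fq k 0 i = 0 := by simp [fq]
  have f1 : fq k 1 i = 2 * k := by simp [fq, Nat.cast_sub hi2]
  simp only [f0, f1, zero_mul, zero_add] at s
  rw [← s]
  have a1 := sum_Hp k i (k + 1) hi2 (by omega) th
  have a2 := sum_Hp k (2 * k - i) (2 * k + 1) (by omega) (by omega) th
  rw [Nat.sub_sub_self hi2] at a2
  rw [show 2 * k + 1 = k + 1 + k by omega, Finset.sum_range_add] at a2
  have a3 := h1 (Hp k i)
  rw [Rf_Hp k i hi2, ← a1, ← a2] at a3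
  have a4 : ∑ q ∈ Finset.range (k + 1), fq k q i * th (X ^ (2 * k - q))
     = ∑ q ∈ Finset.range (k + 1), ((2 * k - i).choose q : ℚ) * th (X ^ (2 * k - q))
      + e * ∑ q ∈ Finset.range (k + 1), (i.choose q : ℚ) * th (X ^ (2 * k - q)) := by
    rw [Finset.mul_sum, ← Finset.sum_add_distrib]
    refine Finset.sum_congr rfl fun q hq => ?_
    have := h4 q (by simp at hq; omega)
    rw [fq]
    linear_combination (-(i.choose q : ℚ)) * this
  rw [a4]
  linear_combination a3

lemma row_p (hk : 1 ≤ k) (h1 : ∀ h, th h + e * th (Rf h) = - la h)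
    (h4 : ∀ q, q ≤ k → th (X ^ (2 * k - q)) * ((-1) ^ q + e) = 0)
    (p : ℕ) (hp : p < k) (he : e = (-1) ^ p) :
    ∑ t ∈ Finset.range k, (-1 : ℚ) ^ (k + 1 + t) * ((2 * k).choose (k + 1 + t) : ℚ) *
      ((2 * k - (k + 1 + t)).choose p : ℚ) *
      (∑ p' ∈ Finset.range k, ((2 * k - (k + 1 + t)).choose p' : ℚ) * la (X ^ (2 * k - p'))
        + 2 * k * th (X ^ (2 * k - 1))
        + ∑ j ∈ Finset.range (k - 1), fq k (j + 2) (k + 1 + t) * th (X ^ (2 * k - (j + 2))))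
     = - ((2 * k).choose p : ℚ) * th (X ^ p) := by
  have e1 : ∀ t ∈ Finset.range k, (-1 : ℚ) ^ (k + 1 + t) * ((2 * k).choose (k + 1 + t) : ℚ) *
      ((2 * k - (k + 1 + t)).choose p : ℚ) *
      (∑ p' ∈ Finset.range k, ((2 * k - (k + 1 + t)).choose p' : ℚ) * la (X ^ (2 * k - p'))
        + 2 * k * th (X ^ (2 * k - 1))
        + ∑ j ∈ Finset.range (k - 1), fq k (j + 2) (k + 1 + t) * th (X ^ (2 * k - (j + 2))))
      = ∑ u ∈ Finset.range k, (-e * th (X ^ (2 * k - (k + 1 + u)))) * ((-1 : ℚ) ^ (k + 1 + t) * ((2 * k).choose (k + 1 + t) : ℚ) *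
      ((2 * k - (k + 1 + t)).choose p : ℚ) * ((k + 1 + t).choose (k + 1 + u) : ℚ)) := by
    intro t ht
    have ht' := Finset.mem_range.1 ht
    have cf := col_fun k e la th hk h1 h4 (k + 1 + t) (by omega) (by omega)
    have cg := sum_Hp k (k + 1 + t) k (by omega) (by omega) la
    have ch : ∑ p' ∈ Finset.range k, ((2 * k - (k + 1 + t)).choose p' : ℚ) * la (X ^ (2 * k - p'))
        + 2 * k * th (X ^ (2 * k - 1))
        + ∑ j ∈ Finset.range (k - 1), fq k (j + 2) (k + 1 + t) * th (X ^ (2 * k - (j + 2)))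
        = ∑ u ∈ Finset.range k, (-e * th (X ^ (2 * k - (k + 1 + u)))) * ((k + 1 + t).choose (k + 1 + u) : ℚ) := by
      have : ∑ u ∈ Finset.range k, (-e * th (X ^ (2 * k - (k + 1 + u)))) * ((k + 1 + t).choose (k + 1 + u) : ℚ)
          = - e * ∑ u ∈ Finset.range k, ((k + 1 + t).choose (k + 1 + u) : ℚ) * th (X ^ (2 * k - (k + 1 + u))) := by
        rw [Finset.mul_sum]
        refine Finset.sum_congr rfl fun u _ => ?_
        ring
      rw [this]
      linear_combination cf + cg
    rw [ch, Finset.mul_sum]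
    refine Finset.sum_congr rfl fun u _ => ?_
    ring
  rw [Finset.sum_congr rfl e1, Finset.sum_comm]
  have e2 : ∀ u ∈ Finset.range k, ∑ t ∈ Finset.range k, (-e * th (X ^ (2 * k - (k + 1 + u)))) * ((-1 : ℚ) ^ (k + 1 + t) * ((2 * k).choose (k + 1 + t) : ℚ) *
      ((2 * k - (k + 1 + t)).choose p : ℚ) * ((k + 1 + t).choose (k + 1 + u) : ℚ))
      = if u = k - 1 - p then - ((2 * k).choose p : ℚ) * th (X ^ p) else 0 := by
    intro u hu
    have hu' := Finset.mem_range.1 hu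
    rw [← Finset.mul_sum, half_sum0 k (fun i => (-1 : ℚ) ^ i * ((2 * k).choose i : ℚ) *
      ((2 * k - i).choose p : ℚ) * (i.choose (k + 1 + u) : ℚ)), sumT _ _ _ (by omega)]
    · by_cases h : u = k - 1 - p
      · rw [if_pos h, if_pos (by omega), show 2 * k - (k + 1 + u) = p by omega]
        have : (-1 : ℚ) ^ p * (-1) ^ (k + 1 + u) = 1 := by
          rw [← pow_add, show p + (k + 1 + u) = 2 * k by omega]; simp
        rw [he]
        linear_combination (- th (X ^ p) * ((2 * k).choose p : ℚ)) * this
      · rw [if_neg h, if_neg (by omega), mul_zero]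
    · intro i hi
      rw [Nat.choose_eq_zero_of_lt (show i < k + 1 + u by omega)]; simp
  rw [Finset.sum_congr rfl e2, Finset.sum_ite_eq' , if_pos (by simp; omega)]

lemma fq_symm (q i : ℕ) (hi : i ≤ 2 * k) : fq k q (2 * k - i) = - (-1) ^ q * fq k q i := by
  rw [fq, fq, Nat.sub_sub_self hi]
  have : (-1 : ℚ) ^ q * (-1) ^ q = 1 := by rw [← mul_pow]; simp
  linear_combination (-(i.choose q : ℚ)) * this

lemma row_q (hk : 1 ≤ k) (h1 : ∀ h, th h + e * th (Rf h) = - la h)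
    (h4 : ∀ q, q ≤ k → th (X ^ (2 * k - q)) * ((-1) ^ q + e) = 0)
    (q : ℕ) (hq : q ≤ k) (he : e = - (-1) ^ q) :
    ∑ t ∈ Finset.range k, (-1 : ℚ) ^ (k + 1 + t) * ((2 * k).choose (k + 1 + t) : ℚ) *
      fq k q (k + 1 + t) *
      (∑ p' ∈ Finset.range k, ((2 * k - (k + 1 + t)).choose p' : ℚ) * la (X ^ (2 * k - p'))
        + 2 * k * th (X ^ (2 * k - 1)))
     - 1 / 2 * (-1) ^ k * ((2 * k).choose k : ℚ) * fq k q k *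
        ∑ j ∈ Finset.range (k - 1), fq k (j + 2) k * th (X ^ (2 * k - (j + 2)))
     = 1 / 2 * ((2 * k).choose q : ℚ) * (la ((X + 1) ^ q) - la (X ^ q)) := by
  have ee : e * e = 1 := by rw [he, neg_mul_neg, ← mul_pow]; simp
  have h2 : ∀ h, la (Rf h) = e * la h := by
    intro h
    have a := h1 h
    have b := h1 (Rf h)
    rw [Rf_Rf] at b
    linear_combination b - e * a + th (Rf h) * ee
  have hc : e * th (X ^ (2 * k - 1)) = th (X ^ (2 * k - 1)) := by
    have := h4 1 hk
    linear_combination this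
  set c := 2 * k * th (X ^ (2 * k - 1)) with hcdef
  set G : ℕ → ℚ := fun i => (-1 : ℚ) ^ i * ((2 * k).choose i : ℚ) * fq k q i * (la (Hp k i) + c) with hG
  have g1 : ∑ i ∈ Finset.range (2 * k + 1), G i = ((2 * k).choose q : ℚ) * (la ((X + 1) ^ q) - la (X ^ q)) := by
    simp only [hG, mul_add]
    rw [Finset.sum_add_distrib, sumF k q, ← Finset.sum_mul, sumF0 k q (by omega)]
    ring
  have g2 := half_sum k G (by
    intro i hi
    simp only [hG]
    rw [fq_symm k q i hi, Nat.choose_symm hi, ← Rf_Hp k i hi, h2, ← he]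
    have : (-1 : ℚ) ^ (2 * k - i) = (-1) ^ i := by
      have : (-1 : ℚ) ^ (2 * k - i) * (-1) ^ i = 1 := by
        rw [← pow_add, Nat.sub_add_cancel hi]; simp
      have t2 : (-1 : ℚ) ^ i * (-1) ^ i = 1 := by rw [← mul_pow]; simp
      linear_combination (-1 : ℚ) ^ i * this - (-1 : ℚ) ^ (2 * k - i) * t2
    rw [this]
    have hc' : e * c = c := by rw [hcdef]; linear_combination 2 * k * hc
    linear_combination ((-1 : ℚ) ^ i * ((2 * k).choose i : ℚ) * fq k q i) * (la (Hp k i) * ee + hc'))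
  have g3 := col_fun k e la th hk h1 h4 k le_rfl (by omega)
  have g4 : ∑ t ∈ Finset.range k, (k.choose (k + 1 + t) : ℚ) * th (X ^ (2 * k - (k + 1 + t))) = 0 := by
    refine Finset.sum_eq_zero fun t _ => ?_
    rw [Nat.choose_eq_zero_of_lt (by omega)]; simp
  rw [g4] at g3
  have g5 : ∑ t ∈ Finset.range k, (-1 : ℚ) ^ (k + 1 + t) * ((2 * k).choose (k + 1 + t) : ℚ) *
      fq k q (k + 1 + t) *
      (∑ p' ∈ Finset.range k, ((2 * k - (k + 1 + t)).choose p' : ℚ) * la (X ^ (2 * k - p')) + c)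
      = ∑ t ∈ Finset.range k, G (k + 1 + t) := by
    refine Finset.sum_congr rfl fun t ht => ?_
    have ht' := Finset.mem_range.1 ht
    rw [sum_Hp k _ k (by omega) (by omega)]
  rw [g5]
  have g6 : G k = (-1 : ℚ) ^ k * ((2 * k).choose k : ℚ) * fq k q k * (la (Hp k k) + c) := rfl
  rw [g1, g6] at g2
  linear_combination (-1/2 : ℚ) * g2 - 1 / 2 * (-1) ^ k * ((2 * k).choose k : ℚ) * fq k q k * g3

end rows

/-! ### the concrete columns -/

noncomputable def laF (k b : ℕ) : ℚ[X] →ₗ[ℚ] ℚ :=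
  if b = 1 then ((2 * k).factorial : ℚ) • Lf
  else if b ≤ k then 0
  else ((3 * k - 1 - b).factorial : ℚ) • (Lf ∘ₗ (derivative ^ (b - k - 1 + 1) : Module.End ℚ ℚ[X]))

noncomputable def opT : ℚ[X] →ₗ[ℚ] ℚ[X] := LinearMap.mulLeft ℚ X ∘ₗ derivative - LinearMap.id

lemma opT_apply (f : ℚ[X]) : opT f = X * derivative f - f := rfl

noncomputable def thF (k b : ℕ) : ℚ[X] →ₗ[ℚ] ℚ :=
  if b = 1 then ((2 * k).factorial : ℚ) • (Lf ∘ₗ LinearMap.mulLeft ℚ X)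
  else if b ≤ k then
    ((2 * k + 1 - b).factorial : ℚ) • (Lf ∘ₗ (derivative ^ (b - 2) : Module.End ℚ ℚ[X]))
  else ((3 * k - 1 - b).factorial : ℚ) •
    (Lf ∘ₗ opT ∘ₗ
      (derivative ^ (b - k - 1) : Module.End ℚ ℚ[X]))

def parF (k b : ℕ) : ℕ := if b ≤ k then b - 1 else b - k

lemma Lf_D (n m : ℕ) : Lf (derivative^[m] (X ^ n)) = (n.descFactorial m : ℚ) * _root_.bernoulli (n - m) := by
  rw [Polynomial.iterate_derivative_X_pow_eq_smul, map_smul, Lf_X_pow]; simp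

lemma la_one (k n : ℕ) : laF k 1 (X ^ n) = (2 * k).factorial * _root_.bernoulli n := by
  simp [laF, Lf_X_pow]
lemma th_one (k n : ℕ) : thF k 1 (X ^ n) = (2 * k).factorial * _root_.bernoulli (n + 1) := by
  simp [thF, ← pow_succ', Lf_X_pow]
lemma la_p (k b : ℕ) (h : 1 < b) (h2 : b ≤ k) (f : ℚ[X]) : laF k b f = 0 := by
  simp [laF, h2, show b ≠ 1 by omega]
lemma th_p (k b n : ℕ) (h : 1 < b) (h2 : b ≤ k) :
    thF k b (X ^ n) = (2 * k + 1 - b).factorial * (n.descFactorial (b - 2) * _root_.bernoulli (n - (b - 2))) := by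
  simp [thF, h2, show b ≠ 1 by omega, Module.End.pow_apply, Lf_D]
lemma la_q (k b n : ℕ) (h : k < b) (hk : 1 ≤ k) :
    laF k b (X ^ n) = (3 * k - 1 - b).factorial *
      (n.descFactorial (b - k - 1 + 1) * _root_.bernoulli (n - (b - k - 1 + 1))) := by
  simp only [laF, show b ≠ 1 by omega, show ¬ b ≤ k by omega, if_false, LinearMap.smul_apply,
    LinearMap.comp_apply, Module.End.pow_apply, Lf_D, smul_eq_mul]
lemma th_q (k b n : ℕ) (h : k < b) (hk : 1 ≤ k) :
    thF k b (X ^ n) = (3 * k - 1 - b).factorial *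
      (n.descFactorial (b - k - 1) * ((n - (b - k - 1) : ℕ) - 1) * _root_.bernoulli (n - (b - k - 1))) := by
  simp only [thF, show b ≠ 1 by omega, show ¬ b ≤ k by omega, if_false, LinearMap.smul_apply,
    LinearMap.comp_apply, Module.End.pow_apply, smul_eq_mul]
  rw [Polynomial.iterate_derivative_X_pow_eq_smul, map_smul, map_smul]
  generalize n - (b - k - 1) = j
  have : opT (X ^ j) = ((j : ℚ) - 1) • X ^ j := by
    rw [opT_apply]
    rcases j with _ | j
    · simp
    · simp [Polynomial.smul_eq_C_mul]; ring
  rw [this, map_smul, Lf_X_pow]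
  simp only [smul_eq_mul]; ring

lemma col_h1 (k b : ℕ) (hk : 1 ≤ k) (hb : 1 ≤ b) (h : ℚ[X]) :
    thF k b h + (-1) ^ parF k b * thF k b (Rf h) = - laF k b h := by
  by_cases b1 : b = 1
  · subst b1
    have : X * Rf h = Rf (-h - X * h) := by
      rw [sub_eq_add_neg, Rf_add, Rf_neg, Rf_neg, Rf_mul, Rf_X]; ring
    simp [thF, laF, parF, hk, this, Lf_Rf]
    ring
  by_cases b2 : b ≤ k
  · obtain ⟨m, rfl⟩ : ∃ m, b = m + 2 := ⟨b - 2, by omega⟩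
    rw [la_p k _ (by omega) b2]
    simp only [thF, parF, b1, b2, if_true, if_false, LinearMap.smul_apply,
      LinearMap.comp_apply, Module.End.pow_apply, smul_eq_mul, iter_der_Rf, map_smul, Lf_Rf]
    have t2 : (-1 : ℚ) ^ m * (-1) ^ m = 1 := by rw [← mul_pow]; simp
    rw [show m + 2 - 1 = m + 1 by omega, show m + 2 - 2 = m by omega, pow_succ]
    linear_combination (-((2 * k + 1 - (m + 2)).factorial : ℚ) * Lf (derivative^[m] h)) * t2
  · obtain ⟨m, rfl⟩ : ∃ m, b = k + 1 + m := ⟨b - k - 1, by omega⟩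
    simp only [thF, laF, parF, b1, b2, if_false, LinearMap.smul_apply,
      LinearMap.comp_apply, Module.End.pow_apply, smul_eq_mul, iter_der_Rf, map_smul,
      show k + 1 + m - k = m + 1 by omega, Nat.add_sub_cancel, Function.iterate_succ_apply']
    set g := derivative^[m] h
    have : opT (Rf g)
       = Rf (X * derivative g + derivative g - g) := by
      rw [opT_apply, der_Rf]
      rw [sub_eq_add_neg _ g, Rf_add, Rf_add, Rf_neg, Rf_mul, Rf_X]; ring
    rw [this, Lf_Rf]
    simp only [opT_apply, map_sub, map_add]
    have t2 : (-1 : ℚ) ^ m * (-1) ^ m = 1 := by rw [← mul_pow]; simp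
    rw [pow_succ]
    linear_combination (-((3 * k - 1 - (k + 1 + m)).factorial : ℚ) * (Lf (X * derivative g) + Lf (derivative g) - Lf g)) * t2

lemma col_h4 (k b : ℕ) (hk : 2 ≤ k) (hb : 1 ≤ b) (hb2 : b ≤ 2 * k - 1) (q : ℕ) (hq : q ≤ k) :
    thF k b (X ^ (2 * k - q)) * ((-1) ^ q + (-1) ^ parF k b) = 0 := by
  rcases Nat.even_or_odd (q + parF k b) with he | he
  · have hz : thF k b (X ^ (2 * k - q)) = 0 := by
      rw [Nat.even_iff] at he
      rw [parF] at he
      by_cases b1 : b = 1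
      · subst b1
        rw [th_one, bern_odd, mul_zero]
        · rw [Nat.odd_iff]; split_ifs at he <;> omega
        · omega
      by_cases b2 : b ≤ k
      · rw [th_p k b _ (by omega) b2, bern_odd, mul_zero, mul_zero]
        · rw [Nat.odd_iff]; split_ifs at he; omega
        · omega
      · rw [th_q k b _ (by omega) (by omega), bern_odd, mul_zero, mul_zero]
        · rw [Nat.odd_iff]; split_ifs at he; omega
        · omega
    rw [hz, zero_mul]
  · have : (-1 : ℚ) ^ q + (-1) ^ parF k b = 0 := by
      rcases Nat.even_or_odd q with h | h
      · have h' : Odd (parF k b) := by rw [Nat.odd_iff] at *; rw [Nat.even_iff] at h; omega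
        rw [h.neg_one_pow, h'.neg_one_pow]; norm_num
      · have h' : Even (parF k b) := by rw [Nat.even_iff]; rw [Nat.odd_iff] at *; omega
        rw [h.neg_one_pow, h'.neg_one_pow]; norm_num
    rw [this, mul_zero]

/-- final values, p-rows -/
lemma val_p (k a b : ℕ) (hk : 2 ≤ k) (ha : 1 ≤ a) (hak : a ≤ k) (hb : 1 ≤ b) (hb2 : b ≤ 2 * k - 1)
    (hpar : parF k a % 2 = parF k b % 2) :
    - ((2 * k).choose (a - 1) : ℚ) * thF k b (X ^ (a - 1)) = if a = b then ((2 * k).factorial : ℚ) / 2 else 0 := by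
  simp only [parF, hak, if_true] at hpar
  by_cases b1 : b = 1
  · subst b1
    rw [if_pos (by omega)] at hpar
    rw [th_one]
    by_cases h : a = 1
    · subst h; norm_num; ring
    · rw [if_neg h, bern_odd, mul_zero, mul_zero]
      · rw [Nat.odd_iff]; omega
      · omega
  by_cases b2 : b ≤ k
  · rw [if_pos b2] at hpar
    rw [th_p k b _ (by omega) b2]
    by_cases h : a = b
    · subst h
      obtain ⟨m, rfl⟩ : ∃ m, a = m + 2 := ⟨a - 2, by omega⟩
      rw [if_pos rfl, show m + 2 - 1 = m + 1 by omega, show m + 2 - 2 = m by omega,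
        show m + 1 - m = 1 by omega, _root_.bernoulli_one]
      have h1 := Nat.choose_mul_factorial_mul_factorial (show m + 1 ≤ 2 * k by omega)
      have h2 := Nat.factorial_mul_descFactorial (show m ≤ m + 1 by omega)
      rw [show m + 1 - m = 1 by omega, Nat.factorial_one, one_mul] at h2
      rw [h2, show 2 * k + 1 - (m + 2) = 2 * k - (m + 1) by omega, ← h1]
      push_cast; ring
    · rw [if_neg h]
      rcases Nat.lt_or_gt_of_ne h with h | h
      · rcases Nat.lt_or_ge (a - 1) (b - 2) with h' | h'
        · rw [Nat.descFactorial_eq_zero_iff_lt.2 h']; simp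
        · exfalso; omega
      · rw [bern_odd]
        · simp
        · rw [Nat.odd_iff]; omega
        · omega
  · rw [if_neg b2] at hpar
    rw [if_neg (by omega), th_q k b _ (by omega) (by omega)]
    rcases Nat.lt_or_ge (a - 1) (b - k - 1) with h' | h'
    · rw [Nat.descFactorial_eq_zero_iff_lt.2 h']; simp
    · by_cases h1 : a - 1 - (b - k - 1) = 1
      · rw [h1]; simp
      · rw [bern_odd _ h1]
        · simp
        · rw [Nat.odd_iff]; omega

lemma val_q (k a b : ℕ) (hk : 2 ≤ k) (hak : k < a) (ha2 : a ≤ 2 * k - 1) (hb : 1 ≤ b) (hb2 : b ≤ 2 * k - 1) :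
    1 / 2 * ((2 * k).choose (a - k + 1) : ℚ) *
      (laF k b ((X + 1) ^ (a - k + 1)) - laF k b (X ^ (a - k + 1))) =
       if a = b then ((2 * k).factorial : ℚ) / 2 else 0 := by
  by_cases b1 : b = 1
  · subst b1
    rw [if_neg (by omega)]
    simp [laF, Lf_X_add_one_pow, Lf_X_pow, show a - k ≠ 0 by omega]
  by_cases b2 : b ≤ k
  · rw [la_p k b (by omega) b2, la_p k b (by omega) b2, if_neg (by omega)]; simp
  · have key : laF k b ((X + 1) ^ (a - k + 1)) - laF k b (X ^ (a - k + 1))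
        = (3 * k - 1 - b).factorial * if a = b then ((a - k + 1).factorial : ℚ) else 0 := by
      simp only [laF, b1, b2, if_false, LinearMap.smul_apply, LinearMap.comp_apply,
        Module.End.pow_apply, smul_eq_mul, ← mul_sub]
      congr 1
      have e1 : ∀ m (f : ℚ[X]), derivative^[m] (f.comp (X + 1)) = (derivative^[m] f).comp (X + 1) := by
        intro m f
        induction m with
        | zero => simp
        | succ m ih => rw [Function.iterate_succ_apply', ih, Function.iterate_succ_apply', Polynomial.derivative_comp]; simp
      have e2 : ((X + 1) ^ (a - k + 1) : ℚ[X]) = (X ^ (a - k + 1) : ℚ[X]).comp (X + 1) := by simp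
      rw [e2, e1, Lf_shift, add_sub_cancel_left, ← Function.iterate_succ_apply' derivative,
        Polynomial.iterate_derivative_X_pow_eq_smul]
      by_cases h : a = b
      · subst h
        rw [if_pos rfl, show (a - k - 1 + 1).succ = a - k + 1 by omega]
        rw [Nat.descFactorial_self, Nat.sub_self]; simp
      · rw [if_neg h]
        rcases Nat.lt_or_gt_of_ne h with h | h
        · rw [Nat.descFactorial_eq_zero_iff_lt.2 (by omega)]; simp
        · have : a - k + 1 - (b - k - 1 + 1).succ ≠ 0 := by omega
          simp
          right; omega
    rw [key]
    split_ifs with h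
    · subst h
      have h1 := Nat.choose_mul_factorial_mul_factorial (show a - k + 1 ≤ 2 * k by omega)
      rw [← h1, show 3 * k - 1 - a = 2 * k - (a - k + 1) by omega]
      push_cast; ring
    · simp

/-! ### matching the matrices -/

noncomputable def nuF (k a : ℕ) : ℚ := 1 + 2 * k * (if a = 1 then (1 : ℚ) else 0)

def sgF (k a : ℕ) : ℕ := if a ≤ k then a / 2 else (a - k + 1) / 2

lemma nuF_ne (k a : ℕ) : nuF k a ≠ 0 := by
  unfold nuF; split_ifs <;> positivity

noncomputable def NF (k c b : ℕ) : ℚ :=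
  if c ≤ k then laF k b (X ^ (2 * k - (c - 1))) + (if c = 1 then 2 * k * thF k b (X ^ (2 * k - 1)) else 0)
  else thF k b (X ^ (2 * k - (c - k + 1)))

lemma sgn_bern (n E1 E2 : ℕ) (hn : 2 ≤ n) (h : n % 2 = 0 → (E1 + E2) % 2 = 0) :
    _root_.bernoulli n / (-1 : ℚ) ^ E1 = (-1) ^ E2 * _root_.bernoulli n := by
  rcases Nat.even_or_odd n with he | he
  · have h1 : (-1 : ℚ) ^ E1 * (-1) ^ E2 = 1 := by
      rw [← pow_add]
      exact (Nat.even_iff.2 (h (Nat.even_iff.1 he))).neg_one_pow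
    have h0 : (-1 : ℚ) ^ E1 ≠ 0 := by positivity
    field_simp
    linear_combination (-_root_.bernoulli n) * h1
  · rw [bern_odd he (by omega)]; simp

lemma NF_zero (k c b : ℕ) (hk : 2 ≤ k) (hc : 1 ≤ c) (hc2 : c ≤ 2 * k - 1) (hb : 1 ≤ b)
    (hb2 : b ≤ 2 * k - 1) (h : parF k c % 2 ≠ parF k b % 2) : NF k c b = 0 := by
  have hth : ∀ q, q ≤ k → (q + parF k b) % 2 = 0 → thF k b (X ^ (2 * k - q)) = 0 := by
    intro q hq hp
    have := col_h4 k b hk hb hb2 q hq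
    rcases mul_eq_zero.1 this with h | h
    · exact h
    · exfalso
      rcases Nat.even_or_odd q with h' | h'
      · have h'' : Even (parF k b) := by rw [Nat.even_iff] at *; omega
        rw [h'.neg_one_pow, h''.neg_one_pow] at h; norm_num at h
      · have h'' : Odd (parF k b) := by rw [Nat.odd_iff] at *; omega
        rw [h'.neg_one_pow, h''.neg_one_pow] at h; norm_num at h
  unfold NF
  by_cases c1 : c ≤ k
  · rw [if_pos c1]
    have hla : laF k b (X ^ (2 * k - (c - 1))) = 0 := by
      have hpc : parF k c = c - 1 := by simp [parF, c1]
      rw [hpc] at h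
      by_cases b1 : b = 1
      · subst b1
        rw [parF, if_pos (by omega)] at h
        rw [la_one, bern_odd, mul_zero]
        · rw [Nat.odd_iff]; omega
        · omega
      by_cases b2 : b ≤ k
      · exact la_p k b (by omega) b2 _
      · rw [parF, if_neg b2] at h
        rw [la_q k b _ (by omega) (by omega), bern_odd]
        · simp
        · rw [Nat.odd_iff]; omega
        · omega
    rw [hla, zero_add]
    split_ifs with h1
    · rw [hth 1 (by omega), mul_zero]
      subst h1
      have hpc : parF k 1 = 0 := by simp [parF, c1]
      rw [hpc] at h; omega
    · rfl
  · rw [if_neg c1]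
    have hpc : parF k c = c - k := by simp [parF, c1]
    rw [hpc] at h
    exact hth _ (by omega) (by omega)

lemma fact_desc (n m r : ℕ) (h : m + r = n) : (n.descFactorial m : ℚ) = (n.factorial : ℚ) / (r.factorial : ℚ) := by
  have := Nat.factorial_mul_descFactorial (show m ≤ n by omega)
  rw [show n - m = r by omega] at this
  rw [eq_div_iff (by positivity)]
  rw [← this]; push_cast; ring

lemma fact_step (n : ℕ) (h : 1 ≤ n) : (n.factorial : ℚ) = n * ((n - 1).factorial : ℚ) := by
  rw [← Nat.mul_factorial_pred (by omega)]; push_cast; rfl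

lemma par_mix (k c b : ℕ) (hc : 1 ≤ c) (hc2 : c ≤ k) (hb : k < b) (hb2 : b ≤ 2 * k - 1)
    (h : (3 * k + 1 - c - b) % 2 = 0) :
    (b + 1 + (3 * k - c - b) / 2 + (c / 2 + (b - k + 1) / 2)) % 2 = 0 := by
  obtain ⟨q, rfl⟩ : ∃ q, b = k + q := ⟨b - k, by omega⟩
  rw [show k + q - k + 1 = q + 1 by omega]
  obtain ⟨x, hx⟩ : ∃ x, c = 2 * x ∨ c = 2 * x + 1 := ⟨c / 2, by omega⟩
  obtain ⟨y, hy⟩ : ∃ y, q + 1 = 2 * y ∨ q + 1 = 2 * y + 1 := ⟨(q + 1) / 2, by omega⟩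
  rcases hx with hx | hx <;> rcases hy with hy | hy
  · rw [show (3 * k - c - (k + q)) / 2 = k - x - y by omega, show c / 2 = x by omega,
      show (q + 1) / 2 = y by omega]
    omega
  · omega
  · omega
  · rw [show (3 * k - c - (k + q)) / 2 = k - x - y - 1 by omega, show c / 2 = x by omega,
      show (q + 1) / 2 = y by omega]
    omega

lemma par_qq (k c b : ℕ) (hc : k < c) (hc2 : c ≤ 2 * k - 1) (hb : k < b) (hb2 : b ≤ 2 * k - 1)
    (h : (4 * k - c - b) % 2 = 0) :
    (c + 1 + (4 * k - 1 - c - b) / 2 + ((c - k + 1) / 2 + (b - k + 1) / 2)) % 2 = 0 := by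
  obtain ⟨q, rfl⟩ : ∃ q, b = k + q := ⟨b - k, by omega⟩
  obtain ⟨r, rfl⟩ : ∃ r, c = k + r := ⟨c - k, by omega⟩
  rw [show k + q - k + 1 = q + 1 by omega, show k + r - k + 1 = r + 1 by omega]
  obtain ⟨x, hx⟩ : ∃ x, r + 1 = 2 * x ∨ r + 1 = 2 * x + 1 := ⟨(r + 1) / 2, by omega⟩
  obtain ⟨y, hy⟩ : ∃ y, q + 1 = 2 * y ∨ q + 1 = 2 * y + 1 := ⟨(q + 1) / 2, by omega⟩
  rcases hx with hx | hx <;> rcases hy with hy | hy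
  · rw [show (4 * k - 1 - (k + r) - (k + q)) / 2 = k - x - y by omega, show (r + 1) / 2 = x by omega,
      show (q + 1) / 2 = y by omega]
    omega
  · omega
  · omega
  · rw [show (4 * k - 1 - (k + r) - (k + q)) / 2 = k - x - y - 1 by omega, show (r + 1) / 2 = x by omega,
      show (q + 1) / 2 = y by omega]
    omega

lemma Bcal_eq (k c b : ℕ) (hk : 2 ≤ k) (hc : 1 ≤ c) (hc2 : c ≤ 2 * k - 1) (hb : 1 ≤ b)
    (hb2 : b ≤ 2 * k - 1) :
    BcalEntry k c b = (2 : ℚ) ^ ((2 : ℤ) - 2 * k) * (nuF k c)⁻¹ * (nuF k b)⁻¹ *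
      (-1) ^ (sgF k c + sgF k b) * NF k c b := by
  unfold BcalEntry
  generalize (2 : ℚ) ^ ((2 : ℤ) - 2 * k) = K
  have hk0 : (2 * (k : ℚ) + 1) ≠ 0 := by positivity
  by_cases c1 : c ≤ k
  · by_cases b1 : b ≤ k
    · rw [if_pos ⟨c1, b1⟩]
      by_cases hc1 : c = 1
      · subst hc1
        have hs := sgn_bern (2 * k + 2 - 1 - b) (k + 1 + (2 * k + 1 - 1 - b) / 2) (sgF k 1 + sgF k b)
          (by omega) (by intro h; simp only [sgF, c1, b1, if_true]; omega)
        rw [mul_div_mul_comm, hs, NF, if_pos c1, if_pos rfl]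
        by_cases hb1 : b = 1
        · subst hb1
          rw [la_one, th_one, show 2 * k + 2 - 1 - 1 = 2 * k by omega,
            show 2 * k - 1 + 1 = 2 * k by omega, show 2 * k - (1 - 1) = 2 * k by omega]
          simp [nuF]
          field_simp
          ring
        · rw [la_p k b (by omega) b1, th_p k b _ (by omega) b1,
            fact_desc (2 * k - 1) (b - 2) (2 * k + 1 - b) (by omega),
            show 2 * k - 1 - (b - 2) = 2 * k + 2 - 1 - b by omega,
            fact_step (2 * k) (by omega)]
          simp [nuF, hb1, hb]
          field_simp
          ring
      · by_cases hb1 : b = 1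
        · subst hb1
          have hs := sgn_bern (2 * k + 2 - c - 1) (k + 1 + (2 * k + 1 - c - 1) / 2) (sgF k c + sgF k 1)
            (by omega) (by intro h; simp only [sgF, c1, b1, if_true]; omega)
          rw [mul_div_mul_comm, hs, NF, if_pos c1, if_neg hc1, la_one,
            show 2 * k - (c - 1) = 2 * k + 2 - c - 1 by omega]
          simp [nuF, hc1, hc]
          field_simp
          ring
        · rw [NF, if_pos c1, if_neg hc1, la_p k b (by omega) b1, if_neg (by omega)]
          simp
    · rw [if_neg (by omega), if_pos (Or.inl c1)]
      rw [min_eq_left (by omega), max_eq_right (by omega)]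
      have hs := sgn_bern (3 * k + 1 - c - b) (b + 1 + (3 * k - c - b) / 2) (sgF k c + sgF k b)
          (by omega) (by
            intro h; simp only [sgF, c1, b1, if_true, if_false]
            exact par_mix k c b (by omega) c1 (by omega) hb2 h)
      rw [mul_div_assoc, hs, NF, if_pos c1, la_q k b _ (by omega) (by omega),
        fact_desc (2 * k - (c - 1)) (b - k - 1 + 1) (3 * k + 1 - c - b) (by omega),
        show 2 * k - (c - 1) - (b - k - 1 + 1) = 3 * k + 1 - c - b by omega,
        show 2 * k - (c - 1) = 2 * k + 1 - c by omega]
      by_cases hc1 : c = 1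
      · subst hc1
        rw [th_q k b _ (by omega) (by omega),
          fact_desc (2 * k - 1) (b - k - 1) (3 * k + 1 - 1 - b) (by omega),
          show 2 * k - 1 - (b - k - 1) = 3 * k + 1 - 1 - b by omega,
          show 2 * k + 1 - 1 = 2 * k by omega,
          fact_step (2 * k) (by omega)]
        have hcast : ((3 * k + 1 - 1 - b : ℕ) : ℚ) = 3 * k - b := by
          rw [show 3 * k + 1 - 1 - b = 3 * k - b by omega, Nat.cast_sub (by omega)]; push_cast; ring
        rw [hcast]
        simp [nuF, show b ≠ 1 by omega]
        field_simp
        ring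
      · simp [nuF, hc1, show b ≠ 1 by omega]
        ring
  · by_cases b1 : b ≤ k
    · rw [if_neg (by omega), if_pos (Or.inr b1)]
      rw [min_eq_right (by omega), max_eq_left (by omega)]
      have hs := sgn_bern (3 * k + 1 - c - b) (c + 1 + (3 * k - c - b) / 2) (sgF k c + sgF k b)
          (by omega) (by
            intro h; simp only [sgF, c1, b1, if_true, if_false]
            have := par_mix k b c (by omega) b1 (by omega) hc2 (by rw [← h]; congr 1; omega)
            rw [show 3 * k - b - c = 3 * k - c - b by omega] at this
            omega)
      rw [mul_div_assoc, hs, NF, if_neg c1]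
      by_cases hb1 : b = 1
      · subst hb1
        rw [th_one, show 2 * k - (c - k + 1) + 1 = 3 * k + 1 - c - 1 by omega,
          fact_step (3 * k + 1 - c - 1) (by omega), show 3 * k + 1 - c - 1 - 1 = 3 * k - 1 - c by omega,
          show 2 * k + 1 - 1 = 2 * k by omega]
        have hcast : ((3 * k + 1 - c - 1 : ℕ) : ℚ) = 3 * k - c := by
          rw [show 3 * k + 1 - c - 1 = 3 * k - c by omega, Nat.cast_sub (by omega)]; push_cast; ring
        have hne : (3 * k - c : ℚ) ≠ 0 := by
          rw [← hcast]; exact_mod_cast (by omega)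
        rw [← hcast] at hne
        have hcc : (c : ℚ) = 3 * k - ((3 * k + 1 - c - 1 : ℕ) : ℚ) := by rw [hcast]; ring
        rw [hcc]
        generalize ((3 * k + 1 - c - 1 : ℕ) : ℚ) = d at *
        simp [nuF, show c ≠ 1 by omega]
        field_simp
        ring
      · rw [th_p k b _ (by omega) b1,
          fact_desc (2 * k - (c - k + 1)) (b - 2) (3 * k + 1 - c - b) (by omega),
          show 2 * k - (c - k + 1) - (b - 2) = 3 * k + 1 - c - b by omega,
          show 2 * k - (c - k + 1) = 3 * k - 1 - c by omega]
        simp [nuF, hb1, show c ≠ 1 by omega]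
        ring
    · rw [if_neg (by omega), if_neg (by omega)]
      have hs := sgn_bern (4 * k - c - b) (c + 1 + (4 * k - 1 - c - b) / 2) (sgF k c + sgF k b)
          (by omega) (by
            intro h; simp only [sgF, c1, b1, if_false]
            exact par_qq k c b (by omega) hc2 (by omega) hb2 h)
      rw [mul_div_assoc, hs, NF, if_neg c1, th_q k b _ (by omega) (by omega),
          fact_desc (2 * k - (c - k + 1)) (b - k - 1) (4 * k - c - b) (by omega),
          show 2 * k - (c - k + 1) - (b - k - 1) = 4 * k - c - b by omega,
          show 2 * k - (c - k + 1) = 3 * k - 1 - c by omega]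
      have hcast : ((4 * k - c - b : ℕ) : ℚ) = 4 * k - c - b := by
        rw [Nat.cast_sub (by omega), Nat.cast_sub (by omega)]; push_cast; ring
      rw [hcast]
      simp [nuF, show c ≠ 1 by omega, show b ≠ 1 by omega]
      ring

noncomputable def gaF (k a i : ℕ) : ℚ :=
  if a ≤ k then ((2 * k - i).choose (a - 1) : ℚ) else fq k (a - k + 1) i

noncomputable def wF (k t : ℕ) : ℚ := (-1 : ℚ) ^ (k + 1 + t) * ((2 * k).choose (k + 1 + t) : ℚ)

noncomputable def GrF (k a c : ℕ) : ℚ :=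
  if k < a ∧ k < c then
    - (1 / 2 * (-1) ^ k * ((2 * k).choose k : ℚ) * fq k (a - k + 1) k * fq k (c - k + 1) k)
  else ∑ t ∈ Finset.range k, wF k t * gaF k a (k + 1 + t) * gaF k c (k + 1 + t)

lemma zsign (k x y : ℕ) : (-1 : ℚ) ^ ((k : ℤ) - (x : ℤ) - (y : ℤ)) = (-1) ^ (k + x + y) := by
  rw [zpow_sub₀ (by norm_num), zpow_sub₀ (by norm_num), zpow_natCast, zpow_natCast, zpow_natCast,
    pow_add, pow_add]
  have h : ∀ n : ℕ, ((-1 : ℚ) ^ n)⁻¹ = (-1) ^ n := by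
    intro n; rw [← inv_pow]; norm_num
  rw [div_eq_mul_inv, div_eq_mul_inv, h, h]

/-- common reshaping of the inner sums -/
lemma inner_sumF (k a : ℕ) (ha : 1 ≤ a) (hak : a ≤ k) (F : ℕ → ℚ) :
    (-1 : ℚ) ^ k * ((∑ s ∈ Finset.Icc 1 (k + 1 - a),
        (-1 : ℚ) ^ s * ((2 * k + 1 - a).choose (k + s) : ℚ) * F s) /
      (((a - 1).factorial : ℚ) * ((2 * k + 1 - a).factorial : ℚ)))
    = (∑ t ∈ Finset.range k, wF k t * ((2 * k - (k + 1 + t)).choose (a - 1) : ℚ) * F (t + 1))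
       / ((2 * k).factorial : ℚ) := by
  have h1 : ∑ s ∈ Finset.Icc 1 (k + 1 - a),
        (-1 : ℚ) ^ s * ((2 * k + 1 - a).choose (k + s) : ℚ) * F s
      = ∑ s ∈ Finset.Icc 1 k,
        (-1 : ℚ) ^ s * ((2 * k + 1 - a).choose (k + s) : ℚ) * F s := by
    apply Finset.sum_subset (Finset.Icc_subset_Icc_right (by omega))
    intro s hs hs'
    rw [Nat.choose_eq_zero_of_lt (by simp at hs hs'; omega)]; simp
  have h2 : ∑ s ∈ Finset.Icc 1 k,
        (-1 : ℚ) ^ s * ((2 * k + 1 - a).choose (k + s) : ℚ) * F s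
      = ∑ t ∈ Finset.range k,
        (-1 : ℚ) ^ (t + 1) * ((2 * k + 1 - a).choose (k + (t + 1)) : ℚ) * F (t + 1) := by
    rw [Finset.range_eq_Ico, Finset.sum_Ico_add' (fun s => (-1 : ℚ) ^ s * ((2 * k + 1 - a).choose (k + s) : ℚ) * F s) 0 k 1]
    rfl
  rw [h1, h2, ← mul_div_assoc, Finset.mul_sum, div_eq_div_iff (by positivity) (by positivity),
    Finset.sum_mul, Finset.sum_mul]
  refine Finset.sum_congr rfl fun t _ => ?_
  have c1 := choose_swap (2 * k) (k + 1 + t) (a - 1)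
  have c2 := Nat.choose_mul_factorial_mul_factorial (show a - 1 ≤ 2 * k by omega)
  rw [show 2 * k - (a - 1) = 2 * k + 1 - a by omega] at c1 c2
  have c1' := congrArg (Nat.cast (R := ℚ)) c1
  have c2' := congrArg (Nat.cast (R := ℚ)) c2
  push_cast at c1' c2'
  rw [show k + (t + 1) = k + 1 + t by omega, wF, show k + 1 + t = k + (t + 1) by omega, pow_add] at *
  linear_combination (-(-1 : ℚ) ^ k * (-1) ^ (t + 1) * ((2 * k + 1 - a).choose (k + (t + 1)) : ℚ) * F (t + 1)) * c2'
    - ((-1 : ℚ) ^ k * (-1) ^ (t + 1) * F (t + 1) * ((a - 1).factorial : ℚ) * ((2 * k + 1 - a).factorial : ℚ)) * c1'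

lemma SigA_eq (k a c : ℕ) (ha : 1 ≤ a) (hak : a ≤ k) (hc : 1 ≤ c) (hck : c ≤ k) :
    SigA k a c = if parF k a % 2 = parF k c % 2 then
      2 ^ (2 * k - 1) / ((2 * k).factorial : ℚ) * nuF k a * nuF k c * (-1) ^ (sgF k a + sgF k c) * GrF k a c
      else 0 := by
  simp only [parF, sgF, GrF, gaF, hak, hck, if_true, show ¬ (k < a ∧ k < c) by omega, if_false]
  rw [SigA, zsign]
  have h := inner_sumF k a ha hak (fun s => ((k - s).choose (c - 1) : ℚ))
  by_cases hp : (a - 1) % 2 = (c - 1) % 2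
  · rw [if_pos hp]
    have h3 : (1 + (-1 : ℚ) ^ (a + c)) / 2 = 1 := by
      rw [(show Even (a + c) by rw [Nat.even_iff]; omega).neg_one_pow]; norm_num
    rw [h3, add_assoc k, pow_add (-1 : ℚ) k]
    have h4 : ∑ t ∈ Finset.range k, wF k t * ((2 * k - (k + 1 + t)).choose (a - 1) : ℚ) * ((2 * k - (k + 1 + t)).choose (c - 1) : ℚ)
       = ∑ t ∈ Finset.range k, wF k t * ((2 * k - (k + 1 + t)).choose (a - 1) : ℚ) * ((k - (t + 1)).choose (c - 1) : ℚ) := by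
      refine Finset.sum_congr rfl fun t _ => ?_
      rw [show k - (t + 1) = 2 * k - (k + 1 + t) by omega]
    rw [h4]
    unfold nuF
    linear_combination ((1 + 2 * k * (if a = 1 then (1 : ℚ) else 0)) *
      (1 + 2 * k * (if c = 1 then (1 : ℚ) else 0)) * 2 ^ (2 * k - 1) * (-1) ^ (a / 2 + c / 2)) * h
  · rw [if_neg hp, (show Odd (a + c) by rw [Nat.odd_iff]; omega).neg_one_pow]; norm_num

lemma SigB_eq (k a c : ℕ) (ha : 1 ≤ a) (hak : a ≤ k) (hc : k < c) :
    SigB k a (c - k) = if parF k a % 2 = parF k c % 2 then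
      2 ^ (2 * k - 1) / ((2 * k).factorial : ℚ) * nuF k a * nuF k c * (-1) ^ (sgF k a + sgF k c) * GrF k a c
      else 0 := by
  simp only [parF, sgF, GrF, gaF, hak, show ¬ c ≤ k by omega, if_true, show ¬ (k < a ∧ k < c) by omega, if_false]
  obtain ⟨b, rfl⟩ : ∃ b, c = k + b := ⟨c - k, by omega⟩
  rw [show k + b - k = b by omega, SigB, zsign]
  have h := inner_sumF k a ha hak (fun s => (((k - s).choose (b + 1) : ℚ) + (-1 : ℚ) ^ b * ((k + s).choose (b + 1) : ℚ)))
  by_cases hp : (a - 1) % 2 = b % 2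
  · rw [if_pos hp]
    have h3 : ((-1 : ℚ) ^ (a - 1) + (-1) ^ b) / 2 = (-1) ^ b := by
      rcases Nat.even_or_odd b with hb | hb
      · rw [hb.neg_one_pow, (show Even (a - 1) by rw [Nat.even_iff] at *; omega).neg_one_pow]; norm_num
      · rw [hb.neg_one_pow, (show Odd (a - 1) by rw [Nat.odd_iff] at *; omega).neg_one_pow]; norm_num
    have h5 : (-1 : ℚ) ^ ((b + 1) / 2) = (-1) ^ b * (-1) ^ (b / 2) := by
      rw [← pow_add]
      rcases Nat.even_or_odd' b with ⟨r, hb | hb⟩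
      · rw [show (b + 1) / 2 = r by omega, show b + b / 2 = r + 2 * r by omega, pow_add _ r, pow_mul]; simp
      · rw [show (b + 1) / 2 = r + 1 by omega, show b + b / 2 = (r + 1) + 2 * r by omega, pow_add _ (r + 1), pow_mul]; simp
    rw [h3, add_assoc k, pow_add (-1 : ℚ) k, pow_add, pow_add _ (a / 2), h5]
    have h4 : ∑ t ∈ Finset.range k, wF k t * ((2 * k - (k + 1 + t)).choose (a - 1) : ℚ) * fq k (b + 1) (k + 1 + t)
       = ∑ t ∈ Finset.range k, wF k t * ((2 * k - (k + 1 + t)).choose (a - 1) : ℚ) *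
          (((k - (t + 1)).choose (b + 1) : ℚ) + (-1 : ℚ) ^ b * ((k + (t + 1)).choose (b + 1) : ℚ)) := by
      refine Finset.sum_congr rfl fun t _ => ?_
      rw [show k - (t + 1) = 2 * k - (k + 1 + t) by omega, fq, show k + (t + 1) = k + 1 + t by omega, pow_succ]
      ring
    rw [h4]
    have h6 : nuF k (k + b) = 1 := by simp [nuF, show k + b ≠ 1 by omega]
    rw [h6]
    unfold nuF
    linear_combination ((1 + 2 * k * (if a = 1 then (1 : ℚ) else 0)) *
      2 ^ (2 * k - 1) * (-1) ^ b * (-1) ^ (a / 2) * (-1) ^ (b / 2)) * h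
  · rw [if_neg hp]
    have h3 : ((-1 : ℚ) ^ (a - 1) + (-1) ^ b) = 0 := by
      rcases Nat.even_or_odd b with hb | hb
      · rw [hb.neg_one_pow, (show Odd (a - 1) by rw [Nat.odd_iff]; rw [Nat.even_iff] at *; omega).neg_one_pow]; norm_num
      · rw [hb.neg_one_pow, (show Even (a - 1) by rw [Nat.even_iff]; rw [Nat.odd_iff] at *; omega).neg_one_pow]; norm_num
    rw [h3]; simp

lemma SigD_eq (k a c : ℕ) (hk : 2 ≤ k) (ha : k < a) (hc : k < c) :
    SigD k (a - k) (c - k) = if parF k a % 2 = parF k c % 2 then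
      2 ^ (2 * k - 1) / ((2 * k).factorial : ℚ) * nuF k a * nuF k c * (-1) ^ (sgF k a + sgF k c) * GrF k a c
      else 0 := by
  simp only [parF, sgF, GrF, gaF, show ¬ c ≤ k by omega, show ¬ a ≤ k by omega, if_true, ha, hc, and_self, if_false]
  obtain ⟨b, rfl⟩ : ∃ b, c = k + b := ⟨c - k, by omega⟩
  obtain ⟨d, rfl⟩ : ∃ d, a = k + d := ⟨a - k, by omega⟩
  have h6 : nuF k (k + b) = 1 := by simp [nuF, show k + b ≠ 1 by omega]
  have h7 : nuF k (k + d) = 1 := by simp [nuF, show k + d ≠ 1 by omega]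
  have hf : ∀ q, fq k q k = (1 - (-1) ^ q) * (k.choose q : ℚ) := by
    intro q; rw [fq, show 2 * k - k = k by omega]; ring
  rw [show k + b - k = b by omega, show k + d - k = d by omega, SigD, h6, h7, hf, hf]
  have hp1 : ∀ x, (1 : ℚ) - (-1) ^ (x + 1) = 1 + (-1) ^ x := by intro x; rw [pow_succ]; ring
  rw [hp1, hp1]
  rcases Nat.even_or_odd b with hb | hb
  · rcases Nat.even_or_odd d with hd | hd
    · rw [if_pos (by rw [Nat.even_iff] at *; omega), hb.neg_one_pow, hd.neg_one_pow]
      rw [show (b + 1) / 2 = b / 2 by rw [Nat.even_iff] at *; omega,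
        show (d + 1) / 2 = d / 2 by rw [Nat.even_iff] at *; omega]
      have c2 := Nat.choose_mul_factorial_mul_factorial (show k ≤ 2 * k by omega)
      rw [show 2 * k - k = k by omega] at c2
      have c2' := congrArg (Nat.cast (R := ℚ)) c2
      push_cast at c2'
      have hinv : ((-1 : ℚ) ^ (d / 2 + b / 2))⁻¹ = (-1) ^ (d / 2 + b / 2) := by
        rw [← inv_pow]; norm_num
      have h2 : (2 : ℚ) ^ (2 * k - 1) = 2 * 4 ^ (k - 1) := by
        rw [show 2 * k - 1 = 2 * (k - 1) + 1 by omega, pow_succ, pow_mul]; norm_num; ring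
      have h3 : (-4 : ℚ) ^ (k - 1) = - (-1) ^ k * 4 ^ (k - 1) := by
        rw [neg_pow]
        obtain ⟨m, rfl⟩ : ∃ m, k = m + 1 := ⟨k - 1, by omega⟩
        rw [Nat.add_sub_cancel, pow_succ]; ring
      rw [div_eq_mul_inv _ ((-1 : ℚ) ^ (d / 2 + b / 2)), hinv, h2, h3, ← c2']
      have : ((2 * k).choose k : ℚ) ≠ 0 := by
        exact_mod_cast (Nat.choose_pos (by omega)).ne'
      field_simp
    · rw [hd.neg_one_pow]; simp
  · rw [hb.neg_one_pow]; simp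

/-- `SigmaMat` on natural indices -/
noncomputable def SigN (k a c : ℕ) : ℚ :=
    if a ≤ k then
      (if c ≤ k then SigA k a c else SigB k a (c - k))
    else
      (if c ≤ k then SigB k c (a - k) else SigD k (a - k) (c - k))

lemma GrF_symm (k a c : ℕ) : GrF k a c = GrF k c a := by
  unfold GrF
  by_cases h : k < a ∧ k < c
  · rw [if_pos h, if_pos h.symm]; ring
  · rw [if_neg h, if_neg (fun h' => h h'.symm)]
    refine Finset.sum_congr rfl fun t _ => ?_
    ring

lemma SigN_eq (k a c : ℕ) (hk : 2 ≤ k) (ha : 1 ≤ a) (hc : 1 ≤ c) :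
    SigN k a c = if parF k a % 2 = parF k c % 2 then
      2 ^ (2 * k - 1) / ((2 * k).factorial : ℚ) * nuF k a * nuF k c * (-1) ^ (sgF k a + sgF k c) * GrF k a c
      else 0 := by
  unfold SigN
  by_cases h1 : a ≤ k <;> by_cases h2 : c ≤ k
  · rw [if_pos h1, if_pos h2, SigA_eq k a c ha h1 hc h2]
  · rw [if_pos h1, if_neg h2, SigB_eq k a c ha h1 (by omega)]
  · rw [if_neg h1, if_pos h2, SigB_eq k c a hc h2 (by omega), GrF_symm]
    simp only [eq_comm (a := parF k c % 2), add_comm (sgF k c)]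
    split_ifs <;> ring
  · rw [if_neg h1, if_neg h2, SigD_eq k a c hk (by omega) (by omega)]

lemma gram_sum (k a b : ℕ) (hk : 2 ≤ k) (ha : 1 ≤ a) (ha2 : a ≤ 2 * k - 1) (hb : 1 ≤ b)
    (hb2 : b ≤ 2 * k - 1) (hpar : parF k a % 2 = parF k b % 2) :
    ∑ i ∈ Finset.range (2 * k - 1), GrF k a (i + 1) * NF k (i + 1) b
      = if a = b then ((2 * k).factorial : ℚ) / 2 else 0 := by
  rw [show 2 * k - 1 = k + (k - 1) by omega, Finset.sum_range_add]
  have hpow : ∀ x y : ℕ, x % 2 = y % 2 → (-1 : ℚ) ^ x = (-1) ^ y := by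
    intro x y h
    rcases Nat.even_or_odd x with h' | h'
    · rw [h'.neg_one_pow, (show Even y by rw [Nat.even_iff] at *; omega).neg_one_pow]
    · rw [h'.neg_one_pow, (show Odd y by rw [Nat.odd_iff] at *; omega).neg_one_pow]
  -- the first block of columns
  have hfirst : ∑ i ∈ Finset.range k, GrF k a (i + 1) * NF k (i + 1) b
      = ∑ t ∈ Finset.range k, wF k t * gaF k a (k + 1 + t) *
        (∑ p' ∈ Finset.range k, ((2 * k - (k + 1 + t)).choose p' : ℚ) * laF k b (X ^ (2 * k - p'))
        + 2 * k * thF k b (X ^ (2 * k - 1))) := by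
    have e1 : ∀ t ∈ Finset.range k,
        ∑ p' ∈ Finset.range k, ((2 * k - (k + 1 + t)).choose p' : ℚ) * laF k b (X ^ (2 * k - p'))
        + 2 * k * thF k b (X ^ (2 * k - 1))
        = ∑ i ∈ Finset.range k, ((2 * k - (k + 1 + t)).choose i : ℚ) * NF k (i + 1) b := by
      intro t _
      have e2 : ∀ i ∈ Finset.range k, ((2 * k - (k + 1 + t)).choose i : ℚ) * NF k (i + 1) b
         = ((2 * k - (k + 1 + t)).choose i : ℚ) * laF k b (X ^ (2 * k - i)) +
           if i = 0 then 2 * k * thF k b (X ^ (2 * k - 1)) else 0 := by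
        intro i hi
        have hi' := Finset.mem_range.1 hi
        rw [NF, if_pos (by omega), Nat.add_sub_cancel]
        by_cases h0 : i = 0
        · subst h0; simp
        · simp [h0]
      rw [Finset.sum_congr rfl e2, Finset.sum_add_distrib, Finset.sum_ite_eq', if_pos (by simp; omega)]
    have e3 : ∑ t ∈ Finset.range k, wF k t * gaF k a (k + 1 + t) *
        (∑ p' ∈ Finset.range k, ((2 * k - (k + 1 + t)).choose p' : ℚ) * laF k b (X ^ (2 * k - p'))
        + 2 * k * thF k b (X ^ (2 * k - 1)))
        = ∑ t ∈ Finset.range k, ∑ i ∈ Finset.range k, wF k t * gaF k a (k + 1 + t) *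
          (((2 * k - (k + 1 + t)).choose i : ℚ) * NF k (i + 1) b) :=
      Finset.sum_congr rfl fun t ht => by rw [e1 t ht, Finset.mul_sum]
    rw [e3, Finset.sum_comm]
    refine Finset.sum_congr rfl fun i hi => ?_
    have hi' := Finset.mem_range.1 hi
    rw [GrF, if_neg (by omega), Finset.sum_mul]
    refine Finset.sum_congr rfl fun t _ => ?_
    rw [show gaF k (i + 1) (k + 1 + t) = ((2 * k - (k + 1 + t)).choose i : ℚ) by
      rw [gaF, if_pos (by omega), Nat.add_sub_cancel]]
    ring
  have hN : ∀ j, NF k (k + j + 1) b = thF k b (X ^ (2 * k - (j + 2))) := by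
    intro j
    rw [NF, if_neg (by omega), show k + j + 1 - k + 1 = j + 2 by omega]
  rw [hfirst]
  by_cases hak : a ≤ k
  · have hR := row_p k _ (laF k b) (thF k b) (by omega) (col_h1 k b (by omega) hb)
      (fun q hq => col_h4 k b hk hb hb2 q hq) (a - 1) (by omega)
      (hpow _ _ (by rw [← hpar, parF, if_pos hak]))
    rw [← val_p k a b hk ha hak hb hb2 hpar, ← hR]
    have hsecond : ∑ j ∈ Finset.range (k - 1), GrF k a (k + j + 1) * NF k (k + j + 1) b
       = ∑ t ∈ Finset.range k, wF k t * gaF k a (k + 1 + t) *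
        ∑ j ∈ Finset.range (k - 1), fq k (j + 2) (k + 1 + t) * thF k b (X ^ (2 * k - (j + 2))) := by
      simp only [Finset.mul_sum]
      rw [Finset.sum_comm]
      refine Finset.sum_congr rfl fun j _ => ?_
      rw [GrF, if_neg (by omega), Finset.sum_mul, hN]
      refine Finset.sum_congr rfl fun t _ => ?_
      rw [show gaF k (k + j + 1) (k + 1 + t) = fq k (j + 2) (k + 1 + t) by
        rw [gaF, if_neg (by omega), show k + j + 1 - k + 1 = j + 2 by omega]]
      ring
    rw [hsecond, ← Finset.sum_add_distrib]
    refine Finset.sum_congr rfl fun t _ => ?_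
    rw [gaF, if_pos hak, wF]
    ring
  · have hR := row_q k ((-1) ^ parF k b) (laF k b) (thF k b) (by omega) (col_h1 k b (by omega) hb)
      (fun q hq => col_h4 k b hk hb hb2 q hq) (a - k + 1) (by omega)
      (by rw [pow_succ, mul_neg_one, neg_neg]; exact hpow _ _ (by rw [← hpar, parF, if_neg hak]))
    rw [← val_q k a b hk (by omega) ha2 hb hb2, ← hR]
    have hsecond : ∑ j ∈ Finset.range (k - 1), GrF k a (k + j + 1) * NF k (k + j + 1) b
       = - (1 / 2 * (-1) ^ k * ((2 * k).choose k : ℚ) * fq k (a - k + 1) k *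
        ∑ j ∈ Finset.range (k - 1), fq k (j + 2) k * thF k b (X ^ (2 * k - (j + 2)))) := by
      rw [Finset.mul_sum, ← Finset.sum_neg_distrib]
      refine Finset.sum_congr rfl fun j _ => ?_
      rw [GrF, if_pos (by omega), hN, show k + j + 1 - k + 1 = j + 2 by omega]
      ring
    rw [hsecond, ← sub_eq_add_neg]
    congr 1
    refine Finset.sum_congr rfl fun t _ => ?_
    rw [gaF, if_neg hak, wF]

/-- inverse of the Betti-type matrix `Σ_{2k-1}` via Bernoulli numbers. -/
theorem Sigma_inverse (k : ℕ) (hk : 2 ≤ k) :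
    SigmaMat k *
      (Matrix.of fun i j : Fin (2 * k - 1) => BcalEntry k ((i : ℕ) + 1) ((j : ℕ) + 1)) = 1 := by
  ext i j
  rw [Matrix.mul_apply, Matrix.one_apply]
  have hi := i.2
  have hj := j.2
  have e1 : ∑ x, SigmaMat k i x * (Matrix.of fun i j : Fin (2 * k - 1) =>
      BcalEntry k ((i : ℕ) + 1) ((j : ℕ) + 1)) x j
      = ∑ x ∈ Finset.range (2 * k - 1), SigN k (i + 1) (x + 1) * BcalEntry k (x + 1) (j + 1) := by
    rw [Finset.sum_range]
    rfl
  rw [e1]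
  have hij : (i = j) ↔ ((i : ℕ) + 1 = j + 1) := by rw [Fin.ext_iff]; omega
  simp only [hij]
  generalize ha : (i : ℕ) + 1 = a
  generalize hb : (j : ℕ) + 1 = b
  by_cases hpar : parF k a % 2 = parF k b % 2
  · have e2 : ∀ x ∈ Finset.range (2 * k - 1), SigN k a (x + 1) * BcalEntry k (x + 1) b
        = (2 ^ (2 * k - 1) / ((2 * k).factorial : ℚ) * (2 : ℚ) ^ ((2 : ℤ) - 2 * k) *
          nuF k a * (nuF k b)⁻¹ * (-1) ^ (sgF k a + sgF k b)) * (GrF k a (x + 1) * NF k (x + 1) b) := by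
      intro x hx
      have hx' := Finset.mem_range.1 hx
      rw [SigN_eq k a (x + 1) hk (by omega) (by omega),
        Bcal_eq k (x + 1) b hk (by omega) (by omega) (by omega) (by omega)]
      by_cases hp : parF k (x + 1) % 2 = parF k b % 2
      · rw [if_pos (by omega)]
        have hn := nuF_ne k (x + 1)
        have hs : (-1 : ℚ) ^ sgF k (x + 1) * (-1) ^ sgF k (x + 1) = 1 := by rw [← mul_pow]; simp
        have hn2 : nuF k (x + 1) * (nuF k (x + 1))⁻¹ = 1 := mul_inv_cancel₀ hn
        rw [pow_add, pow_add, pow_add]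
        generalize nuF k (x + 1) = u at *
        generalize (u)⁻¹ = u' at *
        generalize (-1 : ℚ) ^ sgF k (x + 1) = v at *
        linear_combination (2 ^ (2 * k - 1) / ((2 * k).factorial : ℚ) * (2 : ℚ) ^ ((2 : ℤ) - 2 * k) *
          nuF k a * (nuF k b)⁻¹ * (-1) ^ sgF k a * (-1) ^ sgF k b * GrF k a (x + 1) * NF k (x + 1) b) *
            (u * u' * hs + hn2)
      · rw [NF_zero k (x + 1) b hk (by omega) (by omega) (by omega) (by omega) hp]
        simp
    rw [Finset.sum_congr rfl e2, ← Finset.mul_sum,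
      gram_sum k a b hk (by omega) (by omega) (by omega) (by omega) hpar]
    split_ifs with hab
    · subst hab
      have hn := nuF_ne k a
      have hs : (-1 : ℚ) ^ (sgF k a + sgF k a) = 1 := Even.neg_one_pow ⟨_, rfl⟩
      have h2 : (2 : ℚ) ^ (2 * k - 1) * (2 : ℚ) ^ ((2 : ℤ) - 2 * k) = 2 := by
        rw [← zpow_natCast, ← zpow_add₀ (by norm_num)]
        rw [show ((2 * k - 1 : ℕ) : ℤ) + (2 - 2 * k) = 1 by omega]
        norm_num
      rw [hs]
      field_simp
      linear_combination h2
    · simp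
  · rw [if_neg (by rintro rfl; exact hpar rfl)]
    refine Finset.sum_eq_zero fun x hx => ?_
    have hx' := Finset.mem_range.1 hx
    rw [SigN_eq k a (x + 1) hk (by omega) (by omega),
        Bcal_eq k (x + 1) b hk (by omega) (by omega) (by omega) (by omega)]
    by_cases hp : parF k (x + 1) % 2 = parF k b % 2
    · rw [if_neg (by omega), zero_mul]
    · rw [NF_zero k (x + 1) b hk (by omega) (by omega) (by omega) (by omega) hp]
      simp
end

section
/- (Determinants of Betti matrices.) For every k ≥ 1: det 𝔅_k = (−1)^{k−1}·(2k−1)!·Λ_{2k−1} / 2^{5k−1}, where Λ_{2k−1} = (k/(2k+1))·((−1)^{(k−1)(k−2)/2}/2^{k(2k−3)})·((2k)!)^{2k−1}/∏_{n=1}^{2k} n^n. Moreover, for every odd k ≥ 1: det 𝔟_k = 0. -/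
open scoped BigOperators
open Matrix Polynomial Filter

/-- The Betti matrix `𝔅_k` (entries via Bernoulli numbers). -/
noncomputable def BettiB (k : ℕ) : Matrix (Fin k) (Fin k) ℚ :=
  Matrix.of fun i j =>
    ((-1 : ℚ) ^ ((i : ℕ) + 1 + 1) / 2 ^ (2 * k + 2)) *
      (((2 * k + 1 - ((i : ℕ) + 1)).factorial : ℚ) * ((2 * k + 1 - ((j : ℕ) + 1)).factorial : ℚ) /
        ((2 * k + 2 - ((i : ℕ) + 1) - ((j : ℕ) + 1)).factorial : ℚ)) *
      ((_root_.bernoulli (2 * k + 2 - ((i : ℕ) + 1) - ((j : ℕ) + 1)) : ℚ) : ℚ) /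
      (-1 : ℚ) ^ ((2 * k + 1 - ((i : ℕ) + 1) - ((j : ℕ) + 1)) / 2)

/-- The Betti matrix `𝔟_k` (entries via Bernoulli numbers). -/
noncomputable def Bettib (k : ℕ) : Matrix (Fin k) (Fin k) ℚ :=
  Matrix.of fun i j =>
    ((-1 : ℚ) ^ ((i : ℕ) + 1 + 1) / 2 ^ (2 * k + 3)) *
      (((2 * k + 2 - ((i : ℕ) + 1)).factorial : ℚ) * ((2 * k + 2 - ((j : ℕ) + 1)).factorial : ℚ) /
        ((2 * k + 3 - ((i : ℕ) + 1) - ((j : ℕ) + 1)).factorial : ℚ)) *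
      ((_root_.bernoulli (2 * k + 3 - ((i : ℕ) + 1) - ((j : ℕ) + 1)) : ℚ) : ℚ) /
      (-1 : ℚ) ^ ((2 * k + 2 - ((i : ℕ) + 1) - ((j : ℕ) + 1)) / 2)


namespace BettiAux

/-- coefficients of the (unnormalised) modified spherical Bessel series -/
noncomputable def h (n s : ℕ) : ℚ :=
  ((n + s).factorial : ℚ) / ((s.factorial : ℚ) * 4 ^ s * ((2 * n + 2 * s + 1).factorial : ℚ))

lemma h_rec_zero (n : ℕ) : h n 0 = 2 * (2 * n + 3) * h (n + 1) 0 := by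
  unfold h
  rw [show 2 * (n + 1) + 2 * 0 + 1 = (2 * n + 1) + 1 + 1 by ring,
    show 2 * n + 2 * 0 + 1 = 2 * n + 1 by ring, show n + 1 + 0 = n + 1 by ring]
  simp only [Nat.factorial_succ (2 * n + 1 + 1), Nat.factorial_succ (2 * n + 1),
    Nat.factorial_succ n, add_zero]
  have := Nat.factorial_ne_zero (2 * n + 1)
  push_cast
  field_simp
  ring

lemma h_rec_succ (n s : ℕ) :
    h n (s + 1) = 2 * (2 * n + 3) * h (n + 1) (s + 1) + h (n + 2) s := by
  unfold h
  rw [show 2 * (n + 1) + 2 * (s + 1) + 1 = (2 * n + 2 * s + 3) + 1 + 1 by ring,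
    show 2 * (n + 2) + 2 * s + 1 = (2 * n + 2 * s + 3) + 1 + 1 by ring,
    show 2 * n + 2 * (s + 1) + 1 = (2 * n + 2 * s + 3) by ring,
    show n + 1 + (s + 1) = (n + s + 1) + 1 by ring,
    show n + 2 + s = (n + s + 1) + 1 by ring,
    show n + (s + 1) = (n + s + 1) by ring]
  simp only [Nat.factorial_succ (2 * n + 2 * s + 3 + 1), Nat.factorial_succ (2 * n + 2 * s + 3),
    Nat.factorial_succ (n + s + 1), Nat.factorial_succ s]
  have := Nat.factorial_ne_zero (2 * n + 2 * s + 3)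
  have := Nat.factorial_ne_zero (n + s + 1)
  have := Nat.factorial_ne_zero s
  push_cast
  field_simp
  ring

noncomputable def H (n : ℕ) : PowerSeries ℚ :=
  PowerSeries.mk fun m => if Even m then h n (m / 2) else 0

lemma H_rec (n : ℕ) :
    H n = PowerSeries.C (2 * (2 * n + 3) : ℚ) * H (n + 1) + PowerSeries.X ^ 2 * H (n + 2) := by
  ext m
  rw [map_add, PowerSeries.coeff_C_mul, PowerSeries.coeff_X_pow_mul']
  simp only [H, PowerSeries.coeff_mk]
  rcases Nat.even_or_odd' m with ⟨s, rfl | rfl⟩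
  · rcases s with _ | s
    · simpa using h_rec_zero n
    · have e1 : 2 * (s + 1) / 2 = s + 1 := by omega
      have e2 : 2 * (s + 1) - 2 = 2 * s := by omega
      have e3 : 2 * s / 2 = s := by omega
      have e4 : 2 ≤ 2 * (s + 1) := by omega
      have e5 : Even (2 * (s + 1)) := by simp
      have e6 : Even (2 * s) := by simp
      simp only [e1, e2, e3, e4, e5, e6, if_true]
      exact h_rec_succ n s
  · have e1 : ¬ Even (2 * s + 1) := by simp
    simp only [e1, if_false]
    split_ifs with h1 h2
    · exfalso
      rw [Nat.even_iff] at h2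
      omega
    · simp
    · simp

noncomputable def E (a : ℚ) : PowerSeries ℚ := PowerSeries.rescale a (PowerSeries.exp ℚ)

lemma coeff_E (a : ℚ) (n : ℕ) : PowerSeries.coeff n (E a) = a ^ n / (n.factorial : ℚ) := by
  simp [E, PowerSeries.coeff_rescale, PowerSeries.coeff_exp, div_eq_mul_inv]

lemma X_H0 : PowerSeries.X * H 0 = E (1 / 2) - E (-1 / 2) := by
  ext m
  rw [map_sub, coeff_E, coeff_E]
  rcases m with _ | m
  · simp
  rw [PowerSeries.coeff_succ_X_mul]
  simp only [H, PowerSeries.coeff_mk]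
  rcases Nat.even_or_odd' m with ⟨s, rfl | rfl⟩
  · have e5 : Even (2 * s) := by simp
    have e3 : 2 * s / 2 = s := by omega
    simp only [e5, e3, if_true, h]
    have : (2 * 0 + 2 * s + 1) = 2 * s + 1 := by ring
    rw [this, zero_add]
    have := Nat.factorial_ne_zero (2 * s + 1)
    have := Nat.factorial_ne_zero s
    have e : (-1 / 2 : ℚ) ^ (2 * s + 1) = - (1 / 2) ^ (2 * s + 1) := by
      rw [show (-1 / 2 : ℚ) = - (1 / 2) by ring, Odd.neg_pow ⟨s, rfl⟩]
    rw [e, pow_succ, pow_mul, show (1 / 2 : ℚ) ^ 2 = 1 / 4 by norm_num, div_pow, one_pow]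
    field_simp
    ring
  · have e5 : ¬ Even (2 * s + 1) := by simp
    have e : (-1 / 2 : ℚ) ^ (2 * s + 1 + 1) = (1 / 2) ^ (2 * s + 1 + 1) := by
      rw [show (-1 / 2 : ℚ) = - (1 / 2) by ring, Even.neg_pow ⟨s + 1, by ring⟩]
    simp only [e5, if_false, e, sub_self]

lemma cosh_eq : PowerSeries.C (1 / 2 : ℚ) * (E (1 / 2) + E (-1 / 2)) =
    H 0 + PowerSeries.C (1 / 2 : ℚ) * (PowerSeries.X ^ 2 * H 1) := by
  ext m
  rw [PowerSeries.coeff_C_mul, map_add, map_add, PowerSeries.coeff_C_mul, coeff_E, coeff_E,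
    PowerSeries.coeff_X_pow_mul']
  simp only [H, PowerSeries.coeff_mk]
  rcases Nat.even_or_odd' m with ⟨s, rfl | rfl⟩
  · rcases s with _ | s
    · simp [h]
      try norm_num
    · have e1 : 2 * (s + 1) / 2 = s + 1 := by omega
      have e2 : 2 * (s + 1) - 2 = 2 * s := by omega
      have e3 : 2 * s / 2 = s := by omega
      have e4 : 2 ≤ 2 * (s + 1) := by omega
      have e5 : Even (2 * (s + 1)) := by simp
      have e6 : Even (2 * s) := by simp
      simp only [e1, e2, e3, e4, e5, e6, if_true, h]
      rw [show 2 * 0 + 2 * (s + 1) + 1 = 2 * s + 2 + 1 by ring,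
        show 2 * 1 + 2 * s + 1 = 2 * s + 2 + 1 by ring,
        show 2 * (s + 1) = 2 * s + 2 by ring,
        show 0 + (s + 1) = s + 1 by ring, show 1 + s = s + 1 by ring]
      rw [Nat.factorial_succ (2 * s + 2), Nat.factorial_succ s]
      have := Nat.factorial_ne_zero (2 * s + 2)
      have := Nat.factorial_ne_zero s
      have e : (-1 / 2 : ℚ) ^ (2 * s + 2) = (1 / 2) ^ (2 * s + 2) := by
        rw [show (-1 / 2 : ℚ) = - (1 / 2) by ring, Even.neg_pow ⟨s + 1, by ring⟩]
      rw [e, pow_add, pow_mul, show (1 / 2 : ℚ) ^ 2 = 1 / 4 by norm_num, div_pow, one_pow]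
      push_cast
      field_simp
      ring
  · have e5 : ¬ Even (2 * s + 1) := by simp
    have e : (-1 / 2 : ℚ) ^ (2 * s + 1) = - (1 / 2) ^ (2 * s + 1) := by
      rw [show (-1 / 2 : ℚ) = - (1 / 2) by ring, Odd.neg_pow ⟨s, rfl⟩]
    simp only [e5, if_false, e]
    have : (if 2 ≤ 2 * s + 1 then if Even (2 * s + 1 - 2) then h 1 ((2 * s + 1 - 2) / 2) else 0
        else 0) = 0 := by
      split_ifs with h1 h2
      · exfalso
        rw [Nat.even_iff] at h2
        omega
      · rfl
      · rfl
    rw [this]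
    ring

noncomputable def mu (j : ℕ) : ℚ := _root_.bernoulli (j + 2) / ((j + 2).factorial : ℚ)

noncomputable def M : PowerSeries ℚ := PowerSeries.mk mu

lemma bps_eq : bernoulliPowerSeries ℚ =
    1 - PowerSeries.C (1 / 2 : ℚ) * PowerSeries.X + PowerSeries.X ^ 2 * M := by
  ext m
  rw [map_add, map_sub, PowerSeries.coeff_C_mul, PowerSeries.coeff_X_pow_mul']
  simp only [bernoulliPowerSeries, M, PowerSeries.coeff_mk]
  rcases m with _ | _ | m
  · simp
  · simp [PowerSeries.coeff_one, PowerSeries.coeff_X]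
    try norm_num
  · simp [PowerSeries.coeff_one, PowerSeries.coeff_X, mu]

lemma M_H0 : PowerSeries.C (2 : ℚ) * M * H 0 = H 1 := by
  have hE1 : E (1 / 2) * E (1 / 2) = PowerSeries.exp ℚ := by
    unfold E
    rw [PowerSeries.exp_mul_exp_eq_exp_add]
    norm_num
  have hE2 : E (1 / 2) * E (-1 / 2) = 1 := by
    unfold E
    rw [PowerSeries.exp_mul_exp_eq_exp_add]
    norm_num
  have hb := bernoulliPowerSeries_mul_exp_sub_one ℚ
  rw [← hE1] at hb
  have hX := X_H0
  have hc := cosh_eq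
  have hX0 : (PowerSeries.X : PowerSeries ℚ) ≠ 0 := PowerSeries.X_ne_zero
  have h1 : bernoulliPowerSeries ℚ * H 0 = E (-1 / 2) := by
    apply mul_left_cancel₀ hX0
    linear_combination bernoulliPowerSeries ℚ * hX + E (-1 / 2) * hb
      - bernoulliPowerSeries ℚ * E (1 / 2) * hE2
  rw [bps_eq] at h1
  have h2 : (PowerSeries.C (2 : ℚ)) * PowerSeries.C (1 / 2 : ℚ) = 1 := by
    rw [← map_mul]; norm_num
  have h3 : (PowerSeries.C (1 / 2 : ℚ)) + PowerSeries.C (1 / 2 : ℚ) = 1 := by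
    rw [← map_add]; norm_num
  apply mul_left_cancel₀ (pow_ne_zero 2 hX0)
  linear_combination PowerSeries.C (2 : ℚ) * (h1 + hc + PowerSeries.C (1 / 2 : ℚ) * hX
    - E (-1 / 2) * h3) + PowerSeries.X ^ 2 * H 1 * h2

noncomputable def Phi (n : ℕ) : PowerSeries ℚ := PowerSeries.X ^ n * H (n + 1) * (H 0)⁻¹

lemma H0_cc : PowerSeries.constantCoeff (H 0) = 1 := by
  rw [← PowerSeries.coeff_zero_eq_constantCoeff_apply]
  simp [H, h]

lemma H0_inv : H 0 * (H 0)⁻¹ = 1 := by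
  apply PowerSeries.mul_inv_cancel
  rw [H0_cc]; norm_num

lemma Phi_zero : Phi 0 = PowerSeries.C (2 : ℚ) * M := by
  unfold Phi
  rw [zero_add, ← M_H0]
  linear_combination PowerSeries.C (2 : ℚ) * M * H0_inv

lemma Phi_one : PowerSeries.X * Phi 1 = 1 - PowerSeries.C (6 : ℚ) * Phi 0 := by
  unfold Phi
  have := H_rec 0
  norm_num at this ⊢
  linear_combination H0_inv - (H 0)⁻¹ * this

lemma Phi_rec (n : ℕ) : PowerSeries.X * Phi (n + 2) =
    PowerSeries.X * Phi n - PowerSeries.C (2 * (2 * n + 5) : ℚ) * Phi (n + 1) := by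
  unfold Phi
  have := H_rec (n + 1)
  rw [show (2 * (2 * ((n + 1 : ℕ) : ℚ) + 3)) = 2 * (2 * n + 5) by push_cast; ring] at this
  rw [show n + 2 + 1 = n + 1 + 2 by ring, show n + 1 + 1 = n + 2 by ring] at *
  linear_combination - PowerSeries.X ^ (n + 1) * (H 0)⁻¹ * this

noncomputable def phi (n j : ℕ) : ℚ := PowerSeries.coeff j (Phi n)

lemma phi_zero (j : ℕ) : phi 0 j = 2 * mu j := by
  simp [phi, Phi_zero, M, PowerSeries.coeff_C_mul]

lemma phi_one (j : ℕ) : phi 1 j = - 6 * phi 0 (j + 1) := by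
  have := congrArg (PowerSeries.coeff (j + 1)) Phi_one
  rw [PowerSeries.coeff_succ_X_mul, map_sub, PowerSeries.coeff_C_mul] at this
  simp [PowerSeries.coeff_one] at this
  simp [phi, this]

lemma phi_rec (n j : ℕ) : phi (n + 2) j = phi n j - 2 * (2 * n + 5) * phi (n + 1) (j + 1) := by
  have := congrArg (PowerSeries.coeff (j + 1)) (Phi_rec n)
  rw [PowerSeries.coeff_succ_X_mul, map_sub, PowerSeries.coeff_C_mul,
    PowerSeries.coeff_succ_X_mul] at this
  exact this

lemma phi_lt {n j : ℕ} (hj : j < n) : phi n j = 0 := by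
  unfold phi Phi
  rw [mul_assoc, PowerSeries.coeff_X_pow_mul', if_neg (by omega)]

lemma phi_diag (n : ℕ) : phi n n = ((n + 1).factorial : ℚ) / ((2 * n + 3).factorial : ℚ) := by
  unfold phi Phi
  rw [mul_assoc, PowerSeries.coeff_X_pow_mul', if_pos le_rfl, Nat.sub_self,
    PowerSeries.coeff_zero_eq_constantCoeff_apply, map_mul, PowerSeries.constantCoeff_inv, H0_cc,
    ← PowerSeries.coeff_zero_eq_constantCoeff_apply]
  simp [H, h]
  ring_nf

/-- coefficients of the orthogonal polynomials -/
noncomputable def p : ℕ → ℕ → ℚ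
  | 0, i => if i = 0 then 1 else 0
  | 1, i => if i = 1 then -6 else 0
  | n + 2, 0 => p n 0
  | n + 2, i + 1 => p n (i + 1) - 2 * (2 * n + 5) * p (n + 1) i

lemma p_gt (n : ℕ) : ∀ i, n < i → p n i = 0 := by
  induction n using Nat.strong_induction_on with
  | _ n ih =>
    intro i hi
    match n, i, ih, hi with
    | 0, i, _, hi => simp [p]; omega
    | 1, i, _, hi => simp [p]; omega
    | n + 2, 0, _, hi => omega
    | n + 2, i + 1, ih, hi =>
      simp only [p]
      rw [ih n (by omega) _ (by omega), ih (n + 1) (by omega) _ (by omega)]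
      ring

lemma p_diag_succ (n : ℕ) : p (n + 1) (n + 1) = - 2 * (2 * n + 3) * p n n := by
  rcases n with _ | n
  · simp [p]; norm_num
  · simp only [p]
    rw [p_gt n (n + 1 + 1) (by omega)]
    push_cast
    ring

lemma p_diag (n : ℕ) :
    p n n = (-1) ^ n * ((2 * n + 1).factorial : ℚ) / (n.factorial : ℚ) := by
  induction n with
  | zero => simp [p]
  | succ n ih =>
    rw [p_diag_succ, ih, show 2 * (n + 1) + 1 = 2 * n + 1 + 1 + 1 by ring,
      Nat.factorial_succ (2 * n + 1 + 1), Nat.factorial_succ (2 * n + 1), Nat.factorial_succ n]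
    have := Nat.factorial_ne_zero n
    push_cast
    field_simp
    ring

lemma p_sum (n : ℕ) : ∀ N j, n < N →
    ∑ i ∈ Finset.range N, p n i * (2 * mu (i + j)) = phi n j := by
  induction n using Nat.strong_induction_on with
  | _ n ih =>
    intro N j hN
    match n, ih, hN with
    | 0, _, hN =>
      rw [phi_zero, Finset.sum_eq_single 0]
      · simp [p]
      · intro b _ hb
        simp [p, hb]
      · intro h0
        simp at h0
        omega
    | 1, _, hN =>
      rw [phi_one, phi_zero, Finset.sum_eq_single 1]
      · simp [p, add_comm]
      · intro b _ hb
        simp [p, hb]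
      · intro h0
        simp at h0
        omega
    | n + 2, ih, hN =>
      obtain ⟨N, rfl⟩ : ∃ N', N = N' + 1 := ⟨N - 1, by omega⟩
      rw [phi_rec, ← ih n (by omega) (N + 1) j (by omega),
        ← ih (n + 1) (by omega) N (j + 1) (by omega), Finset.sum_range_succ',
        Finset.sum_range_succ', Finset.mul_sum]
      simp only [p]
      rw [add_sub_right_comm, ← Finset.sum_sub_distrib]
      congr 1
      apply Finset.sum_congr rfl
      intro i _
      rw [show i + 1 + j = i + (j + 1) by ring]
      ring

lemma det_hankel (k : ℕ) :
    (∏ n : Fin k, p n n) * Matrix.det (Matrix.of fun i j : Fin k => 2 * mu ((i : ℕ) + j)) =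
      ∏ n : Fin k, phi n n := by
  have h1 : Matrix.det (Matrix.of fun i j : Fin k => p i j) = ∏ n : Fin k, p n n := by
    rw [Matrix.det_of_lowerTriangular]
    · rfl
    · intro i j hij
      exact p_gt _ _ hij
  have h2 : Matrix.det (Matrix.of fun i j : Fin k => phi i j) = ∏ n : Fin k, phi n n := by
    rw [Matrix.det_of_upperTriangular]
    · rfl
    · intro i j hij
      exact phi_lt hij
  rw [← h1, ← h2, ← Matrix.det_mul]
  congr 1
  ext i j
  rw [Matrix.mul_apply]
  simp only [Matrix.of_apply]
  rw [Fin.sum_univ_eq_sum_range (fun x => p i x * (2 * mu (x + j))) k]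
  exact p_sum i k j i.2

/-- closed form of a diagonal pivot, without sign -/
noncomputable def c (n : ℕ) : ℚ :=
  (n.factorial : ℚ) * ((n + 1).factorial : ℚ) /
    (2 * ((2 * n + 1).factorial : ℚ) * ((2 * n + 3).factorial : ℚ))

lemma det_mu (k : ℕ) : Matrix.det (Matrix.of fun i j : Fin k => mu ((i : ℕ) + j)) =
    ∏ n : Fin k, ((-1) ^ (n : ℕ) * c n) := by
  have h1 := det_hankel k
  have h2 := Matrix.det_mul_column (fun _ : Fin k => (2 : ℚ))
    (Matrix.of fun i j : Fin k => mu ((i : ℕ) + j))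
  simp only [Matrix.of_apply] at h2
  rw [h2, ← mul_assoc, ← Finset.prod_mul_distrib] at h1
  have h3 : ∏ n : Fin k, (p n n * 2) ≠ 0 := by
    apply Finset.prod_ne_zero_iff.2
    intro n _
    rw [p_diag]
    positivity
  apply mul_left_cancel₀ h3
  rw [h1, ← Finset.prod_mul_distrib]
  apply Finset.prod_congr rfl
  intro n _
  rw [p_diag, phi_diag, c]
  have := Nat.factorial_ne_zero (n : ℕ)
  have := Nat.factorial_ne_zero (2 * (n : ℕ) + 1)
  have := Nat.factorial_ne_zero (2 * (n : ℕ) + 3)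
  have e : ((-1 : ℚ) ^ (n : ℕ)) * (-1) ^ (n : ℕ) = 1 := by
    rw [← mul_pow]; simp
  field_simp
  linear_combination - e

lemma S_succ (k : ℕ) :
    (∏ i ∈ Finset.range (k + 1), ((k + 1 + 1 + i).factorial : ℚ)) * ((k + 1).factorial : ℚ) =
      (∏ i ∈ Finset.range k, ((k + 1 + i).factorial : ℚ)) *
        ((2 * k + 1).factorial : ℚ) * ((2 * k + 2).factorial : ℚ) := by
  have h1 := Finset.prod_range_succ (fun i => ((k + 1 + i).factorial : ℚ)) (k + 1)
  rw [Finset.prod_range_succ' (fun i => ((k + 1 + i).factorial : ℚ)) (k + 1),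
    Finset.prod_range_succ (fun i => ((k + 1 + i).factorial : ℚ)) k] at h1
  rw [show k + 1 + (k + 1) = 2 * k + 2 by ring, show k + 1 + k = 2 * k + 1 by ring] at h1
  rw [← h1]
  congr 1
  apply Finset.prod_congr rfl
  intro i _
  rw [show k + 1 + 1 + i = k + 1 + (i + 1) by ring]

lemma closed (k : ℕ) :
    (∏ i ∈ Finset.range k, ((k + 1 + i).factorial : ℚ)) ^ 2 * (∏ n ∈ Finset.range k, c n) *
      ((2 * k + 1) * ∏ n ∈ Finset.Icc 1 (2 * k), (n : ℚ) ^ n) =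
      ((2 * k).factorial : ℚ) ^ (2 * k) := by
  induction k with
  | zero => simp
  | succ k ih =>
    have hS := S_succ k
    have hk : ((k + 1).factorial : ℚ) ≠ 0 := by positivity
    rw [← eq_div_iff hk] at hS
    rw [hS, Finset.prod_range_succ, show 2 * (k + 1) = 2 * k + 1 + 1 by ring,
      Finset.prod_Icc_succ_top (by omega), Finset.prod_Icc_succ_top (by omega)]
    set S := ∏ i ∈ Finset.range k, ((k + 1 + i).factorial : ℚ)
    set T := ∏ n ∈ Finset.range k, c n
    set P := ∏ n ∈ Finset.Icc 1 (2 * k), (n : ℚ) ^ n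
    rw [Nat.factorial_succ (2 * k + 1), Nat.factorial_succ (2 * k)]
    unfold c
    rw [show 2 * k + 3 = 2 * k + 2 + 1 by ring, Nat.factorial_succ (2 * k + 2),
      show 2 * k + 2 = 2 * k + 1 + 1 by ring,
      Nat.factorial_succ (2 * k + 1), Nat.factorial_succ (2 * k), Nat.factorial_succ k]
    set f : ℚ := ((2 * k).factorial : ℚ)
    have hf : f ≠ 0 := by positivity
    have hg : (k.factorial : ℚ) ≠ 0 := by positivity
    push_cast
    have e : ((2 * (k : ℚ) + 1 + 1) * ((2 * k + 1) * f)) ^ (2 * k + 1 + 1) =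
      f ^ (2 * k) * f ^ 2 * (2 * (k : ℚ) + 1 + 1) ^ (2 * k + 1 + 1) *
        (2 * (k : ℚ) + 1) ^ (2 * k + 1 + 1) := by
      rw [mul_pow, mul_pow]; ring
    rw [e, ← ih]
    have : (2 * (k : ℚ) + 1 + 1) ≠ 0 := by positivity
    have : (2 * (k : ℚ) + 1 + 1 + 1) ≠ 0 := by positivity
    have : (2 * (k : ℚ) + 1) ≠ 0 := by positivity
    have : ((k : ℚ) + 1) ≠ 0 := by positivity
    generalize hA : (2 * (k : ℚ) + 1 + 1) ^ (2 * k + 1 + 1) = A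
    rw [pow_succ (2 * (k : ℚ) + 1) (2 * k + 1)]
    generalize hB : (2 * (k : ℚ) + 1) ^ (2 * k + 1) = B
    field_simp
    ring

lemma sign_aux (i j : ℕ) :
    mu (i + j) / (-1 : ℚ) ^ ((i + j + 1) / 2) =
      (-1 : ℚ) ^ ((i + 1) / 2) * mu (i + j) * (-1) ^ (j / 2) := by
  rcases Nat.even_or_odd (i + j) with he | ho
  · have e : (i + j + 1) / 2 = (i + 1) / 2 + j / 2 := by
      rw [Nat.even_iff] at he
      omega
    rw [e]
    have e2 : ((-1 : ℚ) ^ ((i + 1) / 2 + j / 2)) * ((-1 : ℚ) ^ ((i + 1) / 2 + j / 2)) = 1 := by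
      rw [← mul_pow]; simp
    rw [div_eq_iff (by positivity)]
    rw [pow_add] at *
    linear_combination - mu (i + j) * e2
  · have : mu (i + j) = 0 := by
      unfold mu
      rw [bernoulli_eq_zero_of_odd (by rw [Nat.odd_iff] at *; omega) (by omega)]
      simp
    rw [this]; simp

lemma BettiB_rev (k : ℕ) (i j : Fin k) : BettiB k i.rev j.rev =
    ((-1) ^ (k - 1 - (i : ℕ)) / 2 ^ (2 * k + 2) * ((k + 1 + i : ℕ).factorial : ℚ) *
      (-1) ^ (((i : ℕ) + 1) / 2)) *
    ((((k + 1 + j : ℕ).factorial : ℚ) * (-1) ^ ((j : ℕ) / 2)) * mu ((i : ℕ) + j)) := by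
  have hi := i.2
  have hj := j.2
  have hs := sign_aux i j
  simp only [BettiB, Matrix.of_apply, Fin.val_rev]
  rw [show k - ((i : ℕ) + 1) + 1 + 1 = (k - 1 - i) + 2 by omega,
    show 2 * k + 1 - (k - ((i : ℕ) + 1) + 1) = k + 1 + i by omega,
    show 2 * k + 1 - (k - ((j : ℕ) + 1) + 1) = k + 1 + j by omega,
    show 2 * k + 2 - (k - ((i : ℕ) + 1) + 1) - (k - ((j : ℕ) + 1) + 1) = i + j + 2 by omega,
    show k + 1 + (i : ℕ) - (k - ((j : ℕ) + 1) + 1) = i + j + 1 by omega,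
    pow_add]
  have e : ∀ a b x y z w : ℚ, a * (x * y / z) * w / b = a * (x * y) * (w / z / b) := by
    intros; ring
  rw [e]
  change _ * (mu (i + j) / _) = _
  rw [hs]
  ring

lemma sign_prod (k : ℕ) : (∏ i ∈ Finset.range k, (-1 : ℚ) ^ (k - 1 - i)) =
    (-1 : ℚ) ^ (k - 1) * (-1 : ℚ) ^ ((k - 1) * (k - 2) / 2) := by
  rw [Finset.prod_range_reflect (fun i => (-1 : ℚ) ^ i) k, Finset.prod_pow_eq_pow_sum,
    Finset.sum_range_id, ← pow_add]
  congr 1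
  rcases k with _ | _ | k
  · rfl
  · rfl
  · simp only [show k + 1 + 1 - 1 = k + 1 by omega,
      show k + 1 + 1 - 2 = k by omega]
    rw [show (k + 1 + 1) * (k + 1) = (k + 1) * k + (k + 1) * 2 by ring,
      Nat.add_mul_div_right _ _ (by norm_num)]
    ring

lemma det_BettiB_raw (k : ℕ) : Matrix.det (BettiB k) =
    (-1 : ℚ) ^ (k - 1) * (-1 : ℚ) ^ ((k - 1) * (k - 2) / 2) / (2 ^ (2 * k + 2)) ^ k *
    ((∏ i ∈ Finset.range k, ((k + 1 + i).factorial : ℚ)) ^ 2 * (∏ n ∈ Finset.range k, c n)) := by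
  rw [← Matrix.det_submatrix_equiv_self Fin.revPerm (BettiB k)]
  have : (BettiB k).submatrix Fin.revPerm Fin.revPerm = Matrix.of fun i j : Fin k =>
      (((-1) ^ (k - 1 - (i : ℕ)) / 2 ^ (2 * k + 2) * ((k + 1 + i : ℕ).factorial : ℚ) *
      (-1) ^ (((i : ℕ) + 1) / 2)) *
      (Matrix.of fun i j : Fin k => (((k + 1 + j : ℕ).factorial : ℚ) * (-1) ^ ((j : ℕ) / 2)) *
        (Matrix.of fun i j : Fin k => mu ((i : ℕ) + j)) i j) i j) := by
    ext i j
    exact BettiB_rev k i j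
  rw [this, Matrix.det_mul_column, Matrix.det_mul_row, det_mu, ← sign_prod]
  rw [Fin.prod_univ_eq_prod_range (fun i => ((-1 : ℚ) ^ (k - 1 - i) / 2 ^ (2 * k + 2) *
      ((k + 1 + i : ℕ).factorial : ℚ) * (-1) ^ ((i + 1) / 2))) k,
    Fin.prod_univ_eq_prod_range (fun j => (((k + 1 + j : ℕ).factorial : ℚ) * (-1) ^ (j / 2))) k,
    Fin.prod_univ_eq_prod_range (fun n => (-1 : ℚ) ^ n * c n) k]
  have e : ((2 : ℚ) ^ (2 * k + 2)) ^ k = ∏ i ∈ Finset.range k, (2 : ℚ) ^ (2 * k + 2) := by simp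
  rw [e, ← Finset.prod_div_distrib, ← Finset.prod_pow, ← Finset.prod_mul_distrib,
    ← Finset.prod_mul_distrib, ← Finset.prod_mul_distrib, ← Finset.prod_mul_distrib]
  apply Finset.prod_congr rfl
  intro i _
  have e2 : (-1 : ℚ) ^ ((i + 1) / 2) * (-1) ^ (i / 2) * (-1) ^ i = 1 := by
    rw [← pow_add, ← pow_add, Even.neg_one_pow]
    have e3 : (i + 1) / 2 + i / 2 = i := by omega
    rw [e3]
    exact ⟨i, rfl⟩
  linear_combination ((-1 : ℚ) ^ (k - 1 - i) / 2 ^ (2 * k + 2) *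
    (((k + 1 + i : ℕ).factorial : ℚ) ^ 2 * c i)) * e2

lemma det_BettiB (k : ℕ) (hk : 1 ≤ k) :
      Matrix.det (BettiB k) =
        (-1 : ℚ) ^ (k - 1) * ((2 * k - 1).factorial : ℚ) *
          ((k : ℚ) / (2 * k + 1) *
            ((-1 : ℚ) ^ ((k - 1) * (k - 2) / 2) / (2 : ℚ) ^ ((k : ℤ) * (2 * (k : ℤ) - 3))) *
            ((2 * k).factorial : ℚ) ^ (2 * k - 1) / ∏ n ∈ Finset.Icc 1 (2 * k), (n : ℚ) ^ n) /
          2 ^ (5 * k - 1) := by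
  rw [det_BettiB_raw]
  have hc := closed k
  have hP : ∏ n ∈ Finset.Icc 1 (2 * k), (n : ℚ) ^ n ≠ 0 := by
    apply Finset.prod_ne_zero_iff.2
    intro n hn
    have := (Finset.mem_Icc.1 hn).1
    positivity
  have hk1 : (2 * (k : ℚ) + 1) ≠ 0 := by positivity
  rw [← eq_div_iff (mul_ne_zero hk1 hP)] at hc
  rw [hc]
  set P := ∏ n ∈ Finset.Icc 1 (2 * k), (n : ℚ) ^ n
  have h2 : ((2 : ℚ) ^ (2 * k + 2)) ^ k * 2⁻¹ =
      (2 : ℚ) ^ ((k : ℤ) * (2 * (k : ℤ) - 3)) * 2 ^ (5 * k - 1) := by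
    rw [← pow_mul, ← zpow_natCast, ← zpow_natCast, ← _root_.zpow_neg_one, ← zpow_add₀ (by norm_num),
      ← zpow_add₀ (by norm_num)]
    congr 1
    push_cast [Nat.cast_sub (show 1 ≤ 5 * k by omega)]
    ring
  have hz : (2 : ℚ) ^ ((k : ℤ) * (2 * (k : ℤ) - 3)) ≠ 0 := by positivity
  have hf : ((2 * k).factorial : ℚ) = 2 * k * ((2 * k - 1).factorial : ℚ) := by
    rw [← Nat.mul_factorial_pred (show 2 * k ≠ 0 by omega)]
    push_cast
    ring
  have hf2 : ((2 * k).factorial : ℚ) ^ (2 * k) =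
      ((2 * k).factorial : ℚ) ^ (2 * k - 1) * (2 * k * ((2 * k - 1).factorial : ℚ)) := by
    rw [← hf, ← pow_succ]
    congr 1
    omega
  rw [hf2]
  have h2' : ((2 : ℚ) ^ (2 * k + 2)) ^ k =
      2 * ((2 : ℚ) ^ ((k : ℤ) * (2 * (k : ℤ) - 3)) * 2 ^ (5 * k - 1)) := by
    rw [← h2]; ring
  rw [h2']
  generalize (2 : ℚ) ^ ((k : ℤ) * (2 * (k : ℤ) - 3)) = Z at *
  generalize ((2 * k).factorial : ℚ) ^ (2 * k - 1) = W
  generalize (-1 : ℚ) ^ (k - 1) = s1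
  generalize (-1 : ℚ) ^ ((k - 1) * (k - 2) / 2) = s2
  field_simp

lemma det_Bettib (k : ℕ) (hodd : Odd k) : Matrix.det (Bettib k) = 0 := by
  have hM : Matrix.of (fun i j : Fin k => (-1 : ℚ) ^ (i : ℕ) *
      (Matrix.of fun i j : Fin k => (-1 : ℚ) ^ (j : ℕ) * Bettib k i j) i j) = - Bettib k := by
    ext i j
    simp only [Matrix.of_apply, Matrix.neg_apply]
    have hi := i.2
    have hj := j.2
    rcases Nat.even_or_odd ((i : ℕ) + j) with he | ho
    · have : Bettib k i j = 0 := by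
        simp only [Bettib, Matrix.of_apply]
        rw [bernoulli_eq_zero_of_odd (by rw [Nat.even_iff] at he; rw [Nat.odd_iff]; omega)
          (by omega)]
        simp
      rw [this]; simp
    · rw [← mul_assoc, ← pow_add, ho.neg_one_pow]
      ring
  have h1 := congrArg Matrix.det hM
  rw [Matrix.det_mul_column, Matrix.det_mul_row, Matrix.det_neg, Fintype.card_fin,
    hodd.neg_one_pow, ← mul_assoc, ← Finset.prod_mul_distrib] at h1
  have h2 : ∏ i : Fin k, ((-1 : ℚ) ^ (i : ℕ) * (-1) ^ (i : ℕ)) = 1 := by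
    apply Finset.prod_eq_one
    intro i _
    rw [← mul_pow]; simp
  rw [h2] at h1
  change 1 * Matrix.det (Bettib k) = _ at h1
  linarith

end BettiAux


/-- determinants of the Betti matrices. -/
theorem betti_determinants :
    (∀ k : ℕ, 1 ≤ k →
      Matrix.det (BettiB k) =
        (-1 : ℚ) ^ (k - 1) * ((2 * k - 1).factorial : ℚ) *
          ((k : ℚ) / (2 * k + 1) *
            ((-1 : ℚ) ^ ((k - 1) * (k - 2) / 2) / (2 : ℚ) ^ ((k : ℤ) * (2 * (k : ℤ) - 3))) *
            ((2 * k).factorial : ℚ) ^ (2 * k - 1) / ∏ n ∈ Finset.Icc 1 (2 * k), (n : ℚ) ^ n) /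
          2 ^ (5 * k - 1)) ∧
    (∀ k : ℕ, 1 ≤ k → Odd k → Matrix.det (Bettib k) = 0) := by
  refine ⟨fun k hk => BettiAux.det_BettiB k hk, fun k _ hodd => BettiAux.det_Bettib k hodd⟩
end
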